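/- arXiv:1803.02582 — 10 statements merged into one kernel-verified Lean document; each statement's English description precedes it below -/
import Mathlib

section
/- Let R be a commutative Noetherian ring and I a proper ideal of R generated by an R-regular sequence. Then there exists no ideal of R linked by I if and only if I is a prime ideal. -/
/-- `I` is generated by an `R`-regular sequence. -/
def Ideal.IsGenByRegularSequence {R : Type*} [CommRing R] (I : Ideal R) : Prop :=
  ∃ rs : List R, RingTheory.Sequence.IsRegular R rs ∧ I = Ideal.ofList rs

/-- The (proper, nonzero) ideals `a` and `b` are linked by the ideal `I`:
`I` is generated by an `R`-regular sequence, `I ⊆ a ∩ b`, `a = I :_R b` and `b = I :_R a`. -/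
def LinkedBy {R : Type*} [CommRing R] (a b I : Ideal R) : Prop :=
  a ≠ ⊥ ∧ a ≠ ⊤ ∧ b ≠ ⊥ ∧ b ≠ ⊤ ∧ I ≤ a ⊓ b ∧
    Ideal.IsGenByRegularSequence I ∧
    a = Submodule.colon I b ∧ b = Submodule.colon I a

/-- `a` is a linked ideal: it is linked by some ideal `I` to some ideal `b`. -/
def IsLinkedIdeal {R : Type*} [CommRing R] (a : Ideal R) : Prop :=
  ∃ I b : Ideal R, LinkedBy a b I

/-- A proper ideal of a Noetherian ring has an associated prime of the form `I : x`. -/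
lemma Ideal.exists_isPrime_eq_colon_singleton {R : Type*} [CommRing R] [IsNoetherianRing R]
    {I : Ideal R} (hI : I ≠ ⊤) :
    ∃ (p : Ideal R) (x : R), p.IsPrime ∧ ∀ r, r ∈ p ↔ r * x ∈ I := by
  have : Nontrivial (R ⧸ I) := Ideal.Quotient.nontrivial_iff.mpr hI
  obtain ⟨p, hp⟩ := associatedPrimes.nonempty R (R ⧸ I)
  obtain ⟨hp, y, rfl⟩ := isAssociatedPrime_iff.mp hp
  obtain ⟨x, rfl⟩ := Ideal.Quotient.mk_surjective y
  refine ⟨_, x, hp, fun r => ?_⟩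
  rw [Submodule.mem_colon_singleton, Submodule.mem_bot, ← Ideal.Quotient.eq_zero_iff_mem, map_mul]
  rfl

/-- An ideal linking two ideals is not prime. -/
lemma LinkedBy.not_isPrime {R : Type*} [CommRing R] {a b I : Ideal R} (h : LinkedBy a b I) :
    ¬ I.IsPrime := by
  intro hI
  obtain ⟨-, ha, -, hb, -, -, hab, hba⟩ := h
  have hmul : a * b ≤ I := Ideal.mul_le.mpr fun r hr s hs =>
    Submodule.mem_colon.mp (hab ▸ hr) s hs
  rcases hI.mul_le.mp hmul with h | h
  · exact hb (hba.trans ((Submodule.colon_eq_top_iff_subset _).mpr h))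
  · exact ha (hab.trans ((Submodule.colon_eq_top_iff_subset _).mpr h))

/-- A proper non-prime ideal generated by a regular sequence links some pair of ideals. -/
lemma LinkedBy.exists_of_not_isPrime {R : Type*} [CommRing R] [IsNoetherianRing R] {I : Ideal R}
    (hproper : I ≠ ⊤) (hI : I.IsGenByRegularSequence) (hprime : ¬ I.IsPrime) :
    ∃ a b : Ideal R, LinkedBy a b I := by
  obtain ⟨p, x, hp, hpx⟩ := Ideal.exists_isPrime_eq_colon_singleton hproper
  have hIp : I ≤ p := fun r hr => (hpx r).mpr (I.mul_mem_right x hr)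
  have hpI : ¬ p ≤ I := fun h => hprime (le_antisymm hIp h ▸ hp)
  have hx : x ∉ I := fun h => hp.ne_top ((Ideal.eq_top_iff_one p).mpr ((hpx 1).mpr (by simpa)))
  have hxb : x ∈ Submodule.colon I (p : Set R) := Submodule.mem_colon.mpr fun s hs => by
    simpa [mul_comm] using (hpx s).mp hs
  refine ⟨p, Submodule.colon I p, ?_, hp.ne_top, ?_, ?_, le_inf hIp Ideal.le_colon, hI, ?_, rfl⟩
  · rintro rfl
    exact hpI bot_le
  · intro h
    rw [h, Ideal.mem_bot] at hxb
    exact hx (hxb ▸ I.zero_mem)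
  · exact fun h => hpI ((Submodule.colon_eq_top_iff_subset _).mp h)
  · refine le_antisymm (fun r hr => Submodule.mem_colon.mpr fun s hs => ?_) fun r hr =>
      (hpx r).mpr (Submodule.mem_colon.mp hr x hxb)
    simpa [mul_comm] using Submodule.mem_colon.mp hs r hr

/-- For a proper ideal `I` generated by an `R`-regular sequence, there is no
ideal of `R` linked by `I` if and only if `I` is prime. -/
theorem stmt_7 {R : Type*} [CommRing R] [IsNoetherianRing R] (I : Ideal R)
    (hproper : I ≠ ⊤) (hI : I.IsGenByRegularSequence) :
    (¬ ∃ a b : Ideal R, LinkedBy a b I) ↔ I.IsPrime := by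
  exact ⟨fun h => by_contra fun hp => h (LinkedBy.exists_of_not_isPrime hproper hI hp),
    fun hp ⟨_, _, h⟩ => h.not_isPrime hp⟩
end

section
/- Let R be a commutative Noetherian ring and a a nonzero proper radical ideal of R. Then a is a linked ideal if and only if there exist an R-regular sequence x₁,...,xₙ and a nonempty subset Λ of Ass_R(R/(x₁,...,xₙ)) such that a = ⋂_{p ∈ Λ} p. -/
open RingTheory.Sequence

section LinkedRadical

variable {R : Type*} [CommRing R]

lemma isAssociatedPrime_quotient_iff_exists_eq_colon [IsNoetherianRing R] {I p : Ideal R} :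
    IsAssociatedPrime p (R ⧸ I) ↔ p.IsPrime ∧ ∃ x : R, p = Submodule.colon I {x} := by
  rw [isAssociatedPrime_iff, (Submodule.mkQ_surjective I).exists]
  have h (x : R) : (⊥ : Submodule R (R ⧸ I)).colon {I.mkQ x} = Submodule.colon I {x} := by
    ext r
    rw [Submodule.mem_colon_singleton, Submodule.mem_colon_singleton, ← map_smul,
      Submodule.mem_bot, Submodule.mkQ_apply, Submodule.Quotient.mk_eq_zero]
  simp only [h]

lemma minimalPrimes_colon_subset_associatedPrimes [IsNoetherianRing R] (I b : Ideal R) :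
    (Submodule.colon I (b : Set R)).minimalPrimes ⊆ associatedPrimes R (R ⧸ I) := by
  intro p hp
  rw [← Submodule.annihilator_map_mkQ_eq_colon] at hp
  exact (Module.associatedPrimes.minimalPrimes_annihilator_subset_associatedPrimes R
    (Submodule.map I.mkQ b) hp).map_of_injective (Submodule.subtype _)
      (Submodule.subtype_injective _)

lemma exists_eq_colon_of_subset_associatedPrimes [IsNoetherianRing R] {I : Ideal R}
    {Λ : Set (Ideal R)} (hΛ : Λ ⊆ associatedPrimes R (R ⧸ I)) :
    ∃ S : Set R, sInf Λ = Submodule.colon I S := by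
  have h (p : Ideal R) (hp : p ∈ Λ) : ∃ x : R, p = Submodule.colon I {x} :=
    (isAssociatedPrime_quotient_iff_exists_eq_colon.mp (hΛ hp)).2
  choose! x hx using h
  refine ⟨x '' Λ, Ideal.ext fun r ↦ ?_⟩
  rw [Submodule.mem_sInf, Submodule.mem_colon, Set.forall_mem_image]
  refine forall₂_congr fun p hp ↦ ?_
  conv_lhs => rw [hx p hp]
  exact Submodule.mem_colon_singleton

lemma colon_colon_colon (I : Ideal R) (S : Set R) :
    Submodule.colon I (Submodule.colon I (Submodule.colon I S : Set R) : Set R) =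
      Submodule.colon I S := by
  ext r
  simp only [Submodule.mem_colon, SetLike.mem_coe, smul_eq_mul]
  refine ⟨fun h s hs ↦ h s fun t ht ↦ ?_, fun h s hs ↦ ?_⟩
  · rw [mul_comm]
    exact ht s hs
  · rw [mul_comm]
    exact hs r h

lemma RingTheory.Sequence.IsRegular.append_sq {rs : List R} {x : R}
    (h : IsRegular R (rs ++ [x])) : IsRegular R (rs ++ [x ^ 2]) where
  toIsWeaklyRegular := by
    have h' := h.toIsWeaklyRegular
    rw [isWeaklyRegular_append_iff, isWeaklyRegular_singleton_iff] at h' ⊢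
    exact ⟨h'.1, h'.2.pow 2⟩
  top_ne_smul := by
    refine (ne_top_of_le_ne_top h.top_ne_smul.symm (Submodule.smul_mono_left ?_)).symm
    simp only [Ideal.ofList_append, Ideal.ofList_singleton]
    refine sup_le_sup_left ?_ _
    rw [Ideal.span_singleton_le_span_singleton]
    exact Dvd.intro_left (x ^ 1) (by ring)

lemma colon_ofList_append_sq {rs : List R} {x : R} (h : IsWeaklyRegular R (rs ++ [x])) :
    Submodule.colon (Ideal.ofList (rs ++ [x ^ 2])) (Ideal.ofList (rs ++ [x]) : Set R) =
      Ideal.ofList (rs ++ [x]) := by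
  rw [isWeaklyRegular_append_iff, isWeaklyRegular_singleton_iff,
    isSMulRegular_quotient_iff_mem_of_smul_mem] at h
  simp only [smul_eq_mul, Ideal.mul_top] at h
  simp only [Ideal.ofList_append, Ideal.ofList_singleton]
  have hx : x ∈ Ideal.ofList rs ⊔ Ideal.span {x} :=
    Ideal.mem_sup_right (Ideal.mem_span_singleton_self x)
  refine le_antisymm (fun r hr ↦ ?_) fun r hr ↦ Submodule.mem_colon.mpr fun s hs ↦ ?_
  · obtain ⟨u, hu, v, hv, huv⟩ := Submodule.mem_sup.mp (Submodule.mem_colon.mp hr x hx)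
    obtain ⟨c, rfl⟩ := Ideal.mem_span_singleton'.mp hv
    have hmem : r - c * x ∈ Ideal.ofList rs := by
      refine h.2 _ ?_
      convert hu using 1
      rw [smul_eq_mul] at huv
      linear_combination -huv
    exact Submodule.mem_sup.mpr ⟨_, hmem, _, Ideal.mem_span_singleton'.mpr ⟨c, rfl⟩, by ring⟩
  · obtain ⟨u, hu, v, hv, rfl⟩ := Submodule.mem_sup.mp hr
    obtain ⟨u', hu', v', hv', rfl⟩ := Submodule.mem_sup.mp hs
    obtain ⟨c, rfl⟩ := Ideal.mem_span_singleton'.mp hv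
    obtain ⟨d, rfl⟩ := Ideal.mem_span_singleton'.mp hv'
    refine Submodule.mem_sup.mpr ⟨u * (u' + d * x) + c * x * u', ?_, c * d * x ^ 2,
      Ideal.mem_span_singleton'.mpr ⟨_, rfl⟩, by rw [smul_eq_mul]; ring⟩
    exact add_mem (Ideal.mul_mem_right _ _ hu) (Ideal.mul_mem_left _ _ hu')

lemma isLinkedIdeal_ofList {rs : List R} (hrs : IsRegular R rs) (h0 : Ideal.ofList rs ≠ ⊥)
    (h1 : Ideal.ofList rs ≠ ⊤) : IsLinkedIdeal (Ideal.ofList rs) := by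
  rcases rs.eq_nil_or_concat' with rfl | ⟨l, x, rfl⟩
  · exact absurd Ideal.ofList_nil h0
  · have hcolon := colon_ofList_append_sq hrs.toIsWeaklyRegular
    have hle : Ideal.ofList (l ++ [x ^ 2]) ≤ Ideal.ofList (l ++ [x]) :=
      Ideal.le_colon.trans hcolon.le
    exact ⟨_, _, h0, h1, h0, h1, le_inf hle hle, ⟨_, hrs.append_sq, rfl⟩, hcolon.symm,
      hcolon.symm⟩

lemma isLinkedIdeal_colon {I : Ideal R} (hI : I.IsGenByRegularSequence) {S : Set R}
    (h0 : Submodule.colon I S ≠ ⊥) (h1 : Submodule.colon I S ≠ ⊤) :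
    IsLinkedIdeal (Submodule.colon I S) := by
  have hccc := colon_colon_colon I S
  by_cases hle : Submodule.colon I S ≤ I
  · obtain ⟨rs, hrs, rfl⟩ := hI
    rw [le_antisymm hle Ideal.le_colon] at h0 h1 ⊢
    exact isLinkedIdeal_ofList hrs h0 h1
  · refine ⟨I, Submodule.colon I (Submodule.colon I S : Set R), h0, h1, fun hb ↦ ?_,
      fun hb ↦ ?_, le_inf Ideal.le_colon Ideal.le_colon, hI, hccc.symm, rfl⟩
    · rw [hb, Submodule.colon_bot] at hccc
      exact h1 hccc.symm
    · exact hle ((Submodule.colon_eq_top_iff_subset _).mp hb)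

end LinkedRadical

/-- A nonzero proper radical ideal `a` is linked iff it is the intersection of
a nonempty set of associated primes of `R/(x₁,…,xₙ)` for some `R`-regular sequence
`x₁,…,xₙ`. -/
theorem stmt_8 {R : Type*} [CommRing R] [IsNoetherianRing R] (a : Ideal R)
    (ha0 : a ≠ ⊥) (ha1 : a ≠ ⊤) (harad : a.radical = a) :
    IsLinkedIdeal a ↔
      ∃ rs : List R, RingTheory.Sequence.IsRegular R rs ∧
        ∃ Λ ⊆ associatedPrimes R (R ⧸ Ideal.ofList rs), Λ.Nonempty ∧ a = sInf Λ := by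
  constructor
  · rintro ⟨I, b, -, -, -, -, -, ⟨rs, hrs, rfl⟩, hab, -⟩
    refine ⟨rs, hrs, a.minimalPrimes, ?_,
      Set.nonempty_coe_sort.mp (Ideal.nonempty_minimalPrimes ha1), ?_⟩
    · rw [hab]
      exact minimalPrimes_colon_subset_associatedPrimes _ _
    · rw [Ideal.sInf_minimalPrimes, harad]
  · rintro ⟨rs, hrs, Λ, hΛ, -, rfl⟩
    obtain ⟨S, hS⟩ := exists_eq_colon_of_subset_associatedPrimes hΛ
    rw [hS] at ha0 ha1 ⊢
    exact isLinkedIdeal_colon ⟨rs, hrs, rfl⟩ ha0 ha1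
end

section
/- Let R be a commutative Noetherian ring. Then every nonzero maximal ideal of R is a linked ideal, and every nonzero minimal prime ideal of R is a linked ideal. -/
open RingTheory.Sequence in
/-- Appending `y` to a sequence preserves weak regularity iff `y` is a nonzerodivisor modulo the
ideal generated by the sequence. -/
lemma isWeaklyRegular_append_singleton_iff {R : Type*} [CommRing R] (l : List R) (y : R) :
    IsWeaklyRegular R (l ++ [y]) ↔
      IsWeaklyRegular R l ∧ ∀ x, y * x ∈ Ideal.ofList l → x ∈ Ideal.ofList l := by
  rw [isWeaklyRegular_append_iff, isWeaklyRegular_singleton_iff,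
    isSMulRegular_quotient_iff_mem_of_smul_mem]
  simp only [smul_eq_mul, Ideal.mul_top]

lemma isRegular_of_ofList_le {R : Type*} [CommRing R] {l : List R} {a : Ideal R} (ha : a ≠ ⊤)
    (hl : RingTheory.Sequence.IsWeaklyRegular R l) (hla : Ideal.ofList l ≤ a) :
    RingTheory.Sequence.IsRegular R l where
  toIsWeaklyRegular := hl
  top_ne_smul h := by
    rw [smul_eq_mul, Ideal.mul_top] at h
    exact ha (top_le_iff.mp (h ▸ hla))

lemma Ideal.ofList_append_singleton {R : Type*} [CommRing R] (l : List R) (y : R) :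
    Ideal.ofList (l ++ [y]) = Ideal.ofList l ⊔ Ideal.span {y} := by
  rw [Ideal.ofList_append, Ideal.ofList_singleton]

/-- A nonzero prime of the form `I : x`, other than `I` itself, is linked by `I`. -/
lemma isLinkedIdeal_of_eq_colon {R : Type*} [CommRing R] {p I : Ideal R} (hp0 : p ≠ ⊥)
    (hp : p ≠ ⊤) (hI : I.IsGenByRegularSequence) {x : R} (hx : ∀ r, r ∈ p ↔ r * x ∈ I)
    (hpI : ¬ p ≤ I) : IsLinkedIdeal p := by
  have hIp : I ≤ p := fun r hr => (hx r).2 (I.mul_mem_right _ hr)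
  have hxI : x ∉ I := fun h => hp ((Ideal.eq_top_iff_one p).2 ((hx 1).2 (by simpa using h)))
  have hxb : x ∈ Submodule.colon I (p : Set R) := Submodule.mem_colon.2 fun s hs => by
    rw [smul_eq_mul, mul_comm]
    exact (hx s).1 hs
  refine ⟨I, Submodule.colon I p, hp0, hp, ?_, ?_, le_inf hIp Ideal.le_colon, hI, ?_, rfl⟩
  · exact fun h => hxI (by rw [h, Ideal.mem_bot] at hxb; exact hxb ▸ I.zero_mem)
  · exact fun h => hpI ((Submodule.colon_eq_top_iff_subset _).1 h)
  · refine le_antisymm (fun r hr => Submodule.mem_colon.2 fun s hs => ?_) fun r hr => ?_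
    · rw [smul_eq_mul, mul_comm]
      exact Submodule.mem_colon.1 hs r hr
    · exact (hx r).2 (Submodule.mem_colon.1 hr x hxb)

/-- A nonzero maximal ideal generated by a regular sequence is linked: square the last term. -/
lemma isLinkedIdeal_of_isMaximal_of_isWeaklyRegular {R : Type*} [CommRing R] {m : Ideal R}
    (hm : m.IsMaximal) {l : List R} {y : R}
    (hl : RingTheory.Sequence.IsWeaklyRegular R (l ++ [y])) (hlm : Ideal.ofList (l ++ [y]) = m)
    (h0 : m ≠ ⊥) : IsLinkedIdeal m := by
  obtain ⟨hl1, hy⟩ := (isWeaklyRegular_append_singleton_iff l y).1 hl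
  rw [Ideal.ofList_append_singleton] at hlm
  have hlm' : Ideal.ofList l ≤ m := hlm ▸ le_sup_left
  have hym : y ∈ m := hlm ▸ Ideal.mem_sup_right (Ideal.mem_span_singleton_self y)
  have hreg : RingTheory.Sequence.IsWeaklyRegular R (l ++ [y * y]) :=
    (isWeaklyRegular_append_singleton_iff l _).2
      ⟨hl1, fun x hx => hy x (hy _ (by rwa [← mul_assoc]))⟩
  have hyI : y ∉ Ideal.ofList (l ++ [y * y]) := fun h => by
    rw [Ideal.ofList_append_singleton] at h
    obtain ⟨u, hu, v, hv, huv⟩ := Submodule.mem_sup.1 h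
    obtain ⟨r, rfl⟩ := Ideal.mem_span_singleton'.1 hv
    have h1 : 1 - r * y ∈ Ideal.ofList l := hy _ (by
      rwa [show y * (1 - r * y) = u by linear_combination -huv])
    refine hm.ne_top ((Ideal.eq_top_iff_one m).2 ?_)
    simpa using m.add_mem (hlm' h1) (m.mul_mem_left r hym)
  have hle : Ideal.ofList (l ++ [y * y]) ≤ m := by
    rw [Ideal.ofList_append_singleton]
    exact sup_le hlm' ((Ideal.span_singleton_le_iff_mem _).2 (m.mul_mem_left y hym))
  refine isLinkedIdeal_of_eq_colon h0 hm.ne_top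
    ⟨_, isRegular_of_ofList_le hm.ne_top hreg hle, rfl⟩ (x := y) (fun r => ?_)
    fun h => hyI (h hym)
  have hmc : m ≤ Submodule.colon (Ideal.ofList (l ++ [y * y])) ({y} : Set R) := by
    rw [Ideal.ofList_append_singleton, ← hlm]
    refine sup_le (le_sup_left.trans Ideal.le_colon) ?_
    rw [Ideal.span_singleton_le_iff_mem, Submodule.mem_colon_singleton]
    exact Ideal.mem_sup_right (Ideal.mem_span_singleton_self _)
  have heq := hm.eq_of_le (fun h => hyI ?_) hmc
  · conv_lhs => rw [heq]
    rw [Submodule.mem_colon_singleton, smul_eq_mul]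
  · exact (Submodule.colon_eq_top_iff_subset _).1 h rfl

/-- In a Noetherian ring, every proper ideal contains a regular sequence `l` such that the ideal
consists of zerodivisors modulo `l`. -/
lemma exists_isWeaklyRegular_forall_zerodivisor {R : Type*} [CommRing R] [IsNoetherianRing R]
    {a : Ideal R} (ha : a ≠ ⊤) :
    ∃ l : List R, RingTheory.Sequence.IsWeaklyRegular R l ∧ Ideal.ofList l ≤ a ∧
      ∀ y ∈ a, ∃ x, x ∉ Ideal.ofList l ∧ y * x ∈ Ideal.ofList l := by
  obtain ⟨_, ⟨l, hl, hla, rfl⟩, hmax⟩ := set_has_maximal_iff_noetherian.2 ‹IsNoetherianRing R›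
    {J | ∃ l : List R, RingTheory.Sequence.IsWeaklyRegular R l ∧ Ideal.ofList l ≤ a ∧
      Ideal.ofList l = J} ⟨_, [], .nil R R, by simp, rfl⟩
  refine ⟨l, hl, hla, fun y hy => ?_⟩
  by_contra! h
  have hreg := (isWeaklyRegular_append_singleton_iff l y).2
    ⟨hl, fun x hx => by_contra fun hx' => h x hx' hx⟩
  have hle : Ideal.ofList (l ++ [y]) ≤ a := by
    rw [Ideal.ofList_append_singleton]
    exact sup_le hla ((Ideal.span_singleton_le_iff_mem _).2 hy)
  have hyl : y ∈ Ideal.ofList l := by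
    by_contra hyl
    refine hmax _ ⟨_, hreg, hle, rfl⟩ ?_
    rw [Ideal.ofList_append_singleton]
    exact left_lt_sup.2 fun h => hyl ((Ideal.span_singleton_le_iff_mem _).1 h)
  have h1 : (1 : R) ∈ Ideal.ofList l := by
    by_contra h1
    exact h 1 h1 (by simpa using hyl)
  exact ha ((Ideal.eq_top_iff_one a).2 (hla h1))

/-- A maximal ideal consisting of zerodivisors modulo `I` has the form `I : x`. -/
lemma exists_eq_colon_of_forall_zerodivisor {R : Type*} [CommRing R] [IsNoetherianRing R]
    {m I : Ideal R} (hm : m.IsMaximal) (h : ∀ y ∈ m, ∃ x, x ∉ I ∧ y * x ∈ I) :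
    ∃ x, ∀ r, r ∈ m ↔ r * x ∈ I := by
  have hsub : (m : Set R) ⊆ ⋃ p ∈ associatedPrimes R (R ⧸ I), (p : Set R) := by
    rw [biUnion_associatedPrimes_eq_zero_divisors]
    intro y hy
    obtain ⟨x, hx, hyx⟩ := h y hy
    refine ⟨Ideal.Quotient.mk I x, mt Ideal.Quotient.eq_zero_iff_mem.1 hx, ?_⟩
    exact Ideal.Quotient.eq_zero_iff_mem.2 hyx
  obtain ⟨p, hp, hmp⟩ := (m.subset_union_prime_finite (associatedPrimes.finite R (R ⧸ I))
    (f := id) 0 0 fun _ h _ _ => h.1).1 hsub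
  obtain ⟨hprime, x, hx⟩ := isAssociatedPrime_iff.1 hp
  obtain ⟨x, rfl⟩ := Ideal.Quotient.mk_surjective x
  refine ⟨x, fun r => ?_⟩
  rw [show m = p from hm.eq_of_le hprime.ne_top hmp, hx, Submodule.mem_colon_singleton, Submodule.mem_bot]
  exact Ideal.Quotient.eq_zero_iff_mem (a := r * x)


/-- Every nonzero maximal ideal and every nonzero minimal prime of `R` is a
linked ideal. -/
theorem stmt_9 {R : Type*} [CommRing R] [IsNoetherianRing R] :
    (∀ m : Ideal R, m.IsMaximal → m ≠ ⊥ → IsLinkedIdeal m) ∧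
    (∀ p : Ideal R, p ∈ minimalPrimes R → p ≠ ⊥ → IsLinkedIdeal p) := by
  refine ⟨fun m hm h0 => ?_, fun p hp h0 => ?_⟩
  · obtain ⟨l, hl, hlm, hzd⟩ := exists_isWeaklyRegular_forall_zerodivisor hm.ne_top
    by_cases hml : m ≤ Ideal.ofList l
    · have heq := le_antisymm hlm hml
      obtain rfl | ⟨l, y, rfl⟩ := l.eq_nil_or_concat'
      · exact absurd (heq.symm.trans Ideal.ofList_nil) h0
      · exact isLinkedIdeal_of_isMaximal_of_isWeaklyRegular hm hl heq h0
    · obtain ⟨x, hx⟩ := exists_eq_colon_of_forall_zerodivisor hm hzd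
      exact isLinkedIdeal_of_eq_colon h0 hm.ne_top
        ⟨l, isRegular_of_ofList_le hm.ne_top hl hlm, rfl⟩ hx hml
  · have hne : p ≠ ⊤ := hp.1.1.ne_top
    have hass : p ∈ associatedPrimes R R := by
      refine Module.associatedPrimes.minimalPrimes_annihilator_subset_associatedPrimes R R ?_
      rwa [(Module.annihilator_eq_bot (R := R) (M := R)).2 inferInstance]
    obtain ⟨-, x, hx⟩ := isAssociatedPrime_iff.1 hass
    refine isLinkedIdeal_of_eq_colon h0 hne
      ⟨[], isRegular_of_ofList_le hne (.nil R R) (by simp), Ideal.ofList_nil.symm⟩ (x := x)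
      (fun r => ?_) fun h => h0 (le_bot_iff.1 h)
    rw [hx, Submodule.mem_colon_singleton, smul_eq_mul]
end

section
/- Let R be a commutative Noetherian ring which is not reduced. Then the nilradical √0 of R is a linked ideal. -/
/-- An element annihilating the annihilator of a nilpotent ideal is nilpotent. -/
theorem isNilpotent_of_forall_mul_eq_zero {R : Type*} [CommRing R] {N : Ideal R}
    (hN : IsNilpotent N) {x : R}
    (hx : ∀ y, (∀ n ∈ N, y * n = 0) → x * y = 0) : IsNilpotent x := by
  obtain ⟨k, hk⟩ := hN
  have key : ∀ k m : ℕ, (∀ z ∈ N ^ k, x ^ m * z = 0) → IsNilpotent x := by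
    intro k
    induction k with
    | zero =>
      intro m hm
      exact ⟨m, by simpa using hm 1 (by simp)⟩
    | succ k ih =>
      intro m hm
      refine ih (m + 1) fun z hz => ?_
      rw [pow_succ', mul_assoc]
      refine hx _ fun n hn => ?_
      rw [mul_assoc]
      exact hm _ (by rw [pow_succ]; exact Ideal.mul_mem_mul hz hn)
  exact key k 0 fun z hz => by
    rw [hk] at hz
    simpa using hz

/-- If `R` is not reduced, then the nilradical of `R` is a linked ideal. -/
theorem stmt_10 {R : Type*} [CommRing R] [IsNoetherianRing R] (h : ¬ IsReduced R) :
    IsLinkedIdeal (nilradical R) := by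
  have hR : Nontrivial R := by
    by_contra hn
    rw [not_nontrivial_iff_subsingleton] at hn
    exact h inferInstance
  have hbot : nilradical R ≠ ⊥ := fun h0 => h (nilradical_eq_bot_iff.mp h0)
  have htop : nilradical R ≠ ⊤ := by
    rw [Ideal.ne_top_iff_one, mem_nilradical]
    exact not_isNilpotent_one
  have hmem (J : Ideal R) (r : R) :
      r ∈ Submodule.colon (⊥ : Ideal R) (J : Set R) ↔ ∀ n ∈ J, r * n = 0 := by
    rw [Submodule.mem_colon]
    rfl
  have hcolon : nilradical R =
      Submodule.colon (⊥ : Ideal R)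
        ((Submodule.colon (⊥ : Ideal R) (nilradical R : Set R) : Ideal R) : Set R) := by
    refine le_antisymm (fun x hx => ?_) fun x hx => ?_
    · rw [hmem]
      intro y hy
      rw [mul_comm]
      exact (hmem _ _).mp hy x hx
    · rw [mem_nilradical]
      refine isNilpotent_of_forall_mul_eq_zero (IsNoetherianRing.isNilpotent_nilradical R)
        fun y hy => ?_
      exact (hmem _ _).mp hx y ((hmem _ _).mpr hy)
  refine ⟨⊥, Submodule.colon (⊥ : Ideal R) (nilradical R : Set R), hbot, htop, ?_, ?_, bot_le,
    ⟨[], RingTheory.Sequence.IsRegular.nil R R, by simp⟩, hcolon, rfl⟩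
  · intro hb
    refine htop ((Ideal.eq_top_iff_one _).mpr ?_)
    rw [hcolon, hb, hmem]
    simp
  · intro hb
    refine hbot ((Submodule.eq_bot_iff _).mpr fun x hx => ?_)
    have h1 : (1 : R) ∈ Submodule.colon (⊥ : Ideal R) (nilradical R : Set R) := by
      rw [hb]; trivial
    simpa using (hmem _ _).mp h1 x hx
end

section
/- Let R be a commutative Noetherian ring and I an ideal of R generated by an R-regular sequence such that Ass_R(R/I) has no embedded primes, i.e. Ass_R(R/I) = Min Ass_R(R/I). Let I = q₁ ∩ ... ∩ qₙ be a minimal primary decomposition of I and let Λ be a nonempty proper subset of {1,...,n}. Then the ideals a = ⋂_{i ∈ Λ} qᵢ and b = ⋂_{i ∈ {1,...,n} \ Λ} qᵢ are geometrically linked by I; in particular I :_R a = b, I :_R b = a, and a ∩ b = I. -/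
namespace Ideal

variable {R ι : Type*} [CommRing R]

/-- The radical of an irredundant component of a primary decomposition is an associated prime. -/
lemma radical_mem_associatedPrimes_quotient_iInf {q : ι → Ideal R} {i : ι}
    (hprimary : (q i).IsPrimary) (hirred : ¬ (⨅ j ∈ ({i}ᶜ : Set ι), q j) ≤ q i) :
    (q i).radical ∈ associatedPrimes R (R ⧸ ⨅ j, q j) := by
  obtain ⟨x, hx, hxi⟩ := SetLike.not_le_iff_exists.mp hirred
  simp only [Submodule.mem_iInf, Set.mem_compl_iff, Set.mem_singleton_iff] at hx
  have hcolon (r : R) : r ∈ (⊥ : Submodule R (R ⧸ ⨅ j, q j)).colon {Ideal.Quotient.mk _ x} ↔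
      r * x ∈ q i := by
    have hsmul : r • Ideal.Quotient.mk (⨅ j, q j) x = Ideal.Quotient.mk _ (r * x) := rfl
    rw [Submodule.mem_colon_singleton, Submodule.mem_bot, hsmul, Ideal.Quotient.eq_zero_iff_mem,
      Submodule.mem_iInf]
    refine ⟨fun h ↦ h i, fun h j ↦ ?_⟩
    by_cases hj : j = i
    · exact hj ▸ h
    · exact (q j).mul_mem_left r (hx j hj)
  refine ⟨isPrime_radical hprimary, Ideal.Quotient.mk _ x, le_antisymm ?_ ?_⟩
  · exact radical_mono fun r hr ↦ (hcolon r).mpr ((q i).mul_mem_right x hr)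
  · refine (isPrime_radical hprimary).radical_le_iff.mpr fun r hr ↦ ?_
    have hxr : x * r ∈ q i := mul_comm r x ▸ (hcolon r).mp hr
    exact ((isPrimary_iff.mp hprimary).2 hxr).resolve_left hxi

lemma iInf_mem_inf_iInf_mem_compl (q : ι → Ideal R) (s : Set ι) :
    (⨅ i ∈ s, q i) ⊓ (⨅ i ∈ sᶜ, q i) = ⨅ i, q i := by
  rw [← iInf_union, Set.union_compl_self, iInf_univ]

/-- In a finite primary decomposition whose radicals are pairwise incomparable, taking the colon by
the intersection of some of the components leaves the intersection of the others. -/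
lemma colon_iInf_mem_eq_iInf_mem_compl [Finite ι] {q : ι → Ideal R}
    (hprimary : ∀ i, (q i).IsPrimary) (hrad : ∀ i j, (q j).radical ≤ (q i).radical → j = i)
    (s : Set ι) :
    (⨅ i, q i).colon (⨅ i ∈ s, q i : Ideal R) = ⨅ i ∈ sᶜ, q i := by
  cases nonempty_fintype ι
  classical
  refine le_antisymm (le_iInf₂ fun i hi x hx ↦ ?_) fun x hx ↦ ?_
  · have hnle : ¬ (⨅ j ∈ s, q j) ≤ (q i).radical := by
      intro h
      have hinf : s.toFinset.inf q = ⨅ j ∈ s, q j := by simp [Finset.inf_eq_iInf]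
      obtain ⟨j, hj, hji⟩ := (isPrime_radical (hprimary i)).inf_le'.mp (hinf.le.trans h)
      have hle := (isPrime_radical (hprimary i)).radical_le_iff.mpr hji
      exact hi (hrad i j hle ▸ Set.mem_toFinset.mp hj)
    obtain ⟨y, hy, hyi⟩ := SetLike.not_le_iff_exists.mp hnle
    have hxy : x * y ∈ q i := iInf_le q i (Submodule.mem_colon.mp hx y hy)
    exact ((isPrimary_iff.mp (hprimary i)).2 hxy).resolve_right hyi
  · refine Submodule.mem_colon.mpr fun y hy ↦ ?_
    rw [← iInf_mem_inf_iInf_mem_compl q s]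
    exact ⟨Ideal.mul_mem_left _ x hy, Ideal.mul_mem_right y _ hx⟩

lemma iInf_mem_ne_bot_of_irredundant {q : ι → Ideal R}
    (hirred : ∀ i, ¬ (⨅ j ∈ ({i}ᶜ : Set ι), q j) ≤ q i) {s : Set ι} (hs : s ≠ Set.univ) :
    (⨅ i ∈ s, q i) ≠ ⊥ := by
  obtain ⟨i, hi⟩ := (Set.ne_univ_iff_exists_notMem s).mp hs
  intro h
  have hle : (⨅ j ∈ ({i}ᶜ : Set ι), q j) ≤ ⨅ j ∈ s, q j :=
    biInf_mono fun j hj ↦ by rintro rfl; exact hi hj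
  exact hirred i (hle.trans (h.le.trans bot_le))

lemma iInf_mem_ne_top_of_isPrimary {q : ι → Ideal R} (hprimary : ∀ i, (q i).IsPrimary)
    {s : Set ι} (hs : s.Nonempty) : (⨅ i ∈ s, q i) ≠ ⊤ := by
  obtain ⟨i, hi⟩ := hs
  exact ne_top_of_le_ne_top (hprimary i).ne_top (biInf_le q hi)

end Ideal

/-- If `I` is generated by an `R`-regular sequence, `Ass_R(R/I)` has no
embedded primes and `I = q₁ ∩ ⋯ ∩ qₙ` is a minimal primary decomposition, then for every
nonempty proper subset `Λ` of the index set, `⋂_{i ∈ Λ} qᵢ` and `⋂_{i ∉ Λ} qᵢ` are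
geometrically linked by `I`. -/
theorem stmt_11 {R : Type*} [CommRing R] [IsNoetherianRing R] (I : Ideal R)
    (hI : I.IsGenByRegularSequence)
    (hnoemb : ∀ p ∈ associatedPrimes R (R ⧸ I),
      Minimal (· ∈ associatedPrimes R (R ⧸ I)) p)
    (n : ℕ) (q : Fin n → Ideal R) (hprimary : ∀ i, (q i).IsPrimary)
    (hdec : I = ⨅ i, q i)
    (hdist : Function.Injective fun i => (q i).radical)
    (hirred : ∀ i : Fin n, ¬ (⨅ j ∈ ({i}ᶜ : Set (Fin n)), q j) ≤ q i)
    (Λ : Set (Fin n)) (hne : Λ.Nonempty) (hproper : Λ ≠ Set.univ) :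
    LinkedBy (⨅ i ∈ Λ, q i) (⨅ i ∈ Λᶜ, q i) I ∧
      I.colon (⨅ i ∈ Λ, q i) = ⨅ i ∈ Λᶜ, q i ∧
      I.colon (⨅ i ∈ Λᶜ, q i) = ⨅ i ∈ Λ, q i ∧
      (⨅ i ∈ Λ, q i) ⊓ (⨅ i ∈ Λᶜ, q i) = I := by
  subst hdec
  have hrad (i j : Fin n) (hle : (q j).radical ≤ (q i).radical) : j = i := by
    have hmem (k : Fin n) := Ideal.radical_mem_associatedPrimes_quotient_iInf
      (hprimary k) (hirred k)
    exact hdist (le_antisymm hle ((hnoemb _ (hmem i)).2 (hmem j) hle))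
  have hcolon := Ideal.colon_iInf_mem_eq_iInf_mem_compl hprimary hrad Λ
  have hcolon' := Ideal.colon_iInf_mem_eq_iInf_mem_compl hprimary hrad Λᶜ
  rw [compl_compl] at hcolon'
  have hinf := Ideal.iInf_mem_inf_iInf_mem_compl q Λ
  have hcoe (s : Set (Fin n)) : ((⨅ i ∈ s, q i : Ideal R) : Set R) = ⨅ i ∈ s, (q i : Set R) := by
    simp
  exact ⟨⟨Ideal.iInf_mem_ne_bot_of_irredundant hirred hproper,
    Ideal.iInf_mem_ne_top_of_isPrimary hprimary hne,
    Ideal.iInf_mem_ne_bot_of_irredundant hirred (Set.compl_ne_univ.mpr hne),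
    Ideal.iInf_mem_ne_top_of_isPrimary hprimary (Set.nonempty_compl.mpr hproper),
    hinf.ge, hI, hcolon'.symm, hcolon.symm⟩, hcoe Λ ▸ hcolon, hcoe Λᶜ ▸ hcolon', hinf⟩
end

section
/- Let R be a commutative Noetherian ring and I a radical ideal of R generated by an R-regular sequence. Then every ideal of R which is linked by I is a radical ideal. -/
/-- The colon of a radical ideal by any set is radical. -/
theorem Ideal.radical_colon_eq_of_radical_eq {R : Type*} [CommRing R] {I : Ideal R}
    (hI : I.radical = I) (S : Set R) : (Submodule.colon I S).radical = Submodule.colon I S := by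
  refine le_antisymm ?_ Ideal.le_radical
  rintro x ⟨n, hn⟩
  rw [Submodule.mem_colon] at hn ⊢
  intro y hy
  rw [← hI]
  refine ⟨n + 1, ?_⟩
  have h : (x • y) ^ (n + 1) = (x * y ^ n) * (x ^ n • y) := by
    simp only [smul_eq_mul]
    ring
  rw [h]
  exact I.mul_mem_left _ (hn y hy)

/-- If `I` is a radical ideal generated by an `R`-regular sequence, then every
ideal linked by `I` is radical. -/
theorem stmt_12 {R : Type*} [CommRing R] [IsNoetherianRing R] (I : Ideal R)
    (hI : I.IsGenByRegularSequence) (hrad : I.radical = I) :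
    ∀ a b : Ideal R, LinkedBy a b I → a.radical = a := by
  rintro a b ⟨-, -, -, -, -, -, ha, -⟩
  rw [ha]
  exact Ideal.radical_colon_eq_of_radical_eq hrad _
end

section
/- Let R be a commutative Noetherian ring and I a radical ideal of R generated by an R-regular sequence. Then an ideal a of R is linked by I if and only if a = ⋂_{p ∈ Λ} p for some nonempty proper subset Λ of Ass_R(R/I). In that case, a and the ideal b := ⋂_{p ∈ Ass_R(R/I) \ Λ} p are geometrically linked by I. -/
/-- In a Noetherian ring, the associated primes of a radical ideal are its minimal primes. -/
theorem Ideal.associatedPrimes_quotient_eq_minimalPrimes {R : Type*} [CommRing R]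
    [IsNoetherianRing R] {I : Ideal R} (hrad : I.IsRadical) :
    associatedPrimes R (R ⧸ I) = I.minimalPrimes := by
  apply Set.Subset.antisymm
  · intro p hp
    obtain ⟨hpp, x, hx⟩ := isAssociatedPrime_iff.mp hp
    obtain ⟨x, rfl⟩ := Ideal.Quotient.mk_surjective x
    have hmem (r : R) : r ∈ p ↔ r * x ∈ I := by
      rw [hx, Submodule.mem_colon_singleton, Submodule.mem_bot, ← Ideal.Quotient.eq_zero_iff_mem,
        map_mul]
      rfl
    have hxI : x ∉ I := fun h => hpp.ne_top <| (Ideal.eq_top_iff_one p).mpr <| by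
      rwa [hmem, one_mul]
    obtain ⟨m, hm, hxm⟩ : ∃ m ∈ I.minimalPrimes, x ∉ m := by
      by_contra! h
      rw [← hrad.radical, ← Ideal.sInf_minimalPrimes] at hxI
      exact hxI (Submodule.mem_sInf.mpr h)
    have hpm : p ≤ m := fun r hr =>
      (hm.1.1.mem_or_mem (hm.1.2 ((hmem r).mp hr))).resolve_right hxm
    have hIp : I ≤ p := fun r hr => (hmem r).mpr (I.mul_mem_right x hr)
    rwa [le_antisymm hpm (hm.2 ⟨hpp, hIp⟩ hpm)]
  · simpa only [Ideal.annihilator_quotient] using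
      Module.associatedPrimes.minimalPrimes_annihilator_subset_associatedPrimes R (R ⧸ I)

/-- The colon of a radical ideal `I` by `b` is the intersection of the minimal primes of `I`
that do not contain `b`. -/
theorem Ideal.colon_eq_sInf_minimalPrimes {R : Type*} [CommRing R] {I : Ideal R}
    (hrad : I.IsRadical) (b : Ideal R) :
    Submodule.colon I (b : Set R) = sInf {p ∈ I.minimalPrimes | ¬ b ≤ p} := by
  ext x
  simp only [Submodule.mem_colon, Submodule.mem_sInf, Set.mem_ofPred_eq, smul_eq_mul,
    SetLike.mem_coe]
  constructor
  · rintro h p ⟨hp, hbp⟩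
    obtain ⟨y, hyb, hyp⟩ := SetLike.not_le_iff_exists.mp hbp
    exact (hp.1.1.mem_or_mem (hp.1.2 (h y hyb))).resolve_right hyp
  · intro h y hy
    rw [← hrad.radical, ← Ideal.sInf_minimalPrimes, Submodule.mem_sInf]
    intro p hp
    by_cases hbp : b ≤ p
    · exact Ideal.mul_mem_left p x (hbp hy)
    · exact Ideal.mul_mem_right y p (h p ⟨hp, hbp⟩)

/-- In a Noetherian ring, the intersection of a set `Λ` of minimal primes of `I` is contained in
a minimal prime of `I` only if that prime belongs to `Λ`. -/
theorem Ideal.sInf_le_minimalPrime_iff {R : Type*} [CommRing R] [IsNoetherianRing R]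
    {I : Ideal R} {Λ : Set (Ideal R)} (hΛ : Λ ⊆ I.minimalPrimes) {p : Ideal R}
    (hp : p ∈ I.minimalPrimes) : sInf Λ ≤ p ↔ p ∈ Λ := by
  refine ⟨fun h => ?_, fun h => sInf_le h⟩
  have hfin : Λ.Finite := I.finite_minimalPrimes_of_isNoetherianRing.subset hΛ
  rw [← hfin.coe_toFinset, ← hfin.toFinset.inf_id_eq_sInf, hp.1.1.inf_le'] at h
  obtain ⟨q, hq, hqp⟩ := h
  rw [hfin.mem_toFinset] at hq
  rwa [le_antisymm (hp.2 (hΛ hq).1 hqp) hqp]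

/-- In a Noetherian ring, the colon of a radical ideal `I` by the intersection of a set of its
minimal primes is the intersection of the remaining minimal primes. -/
theorem Ideal.colon_sInf_eq_sInf_diff {R : Type*} [CommRing R] [IsNoetherianRing R]
    {I : Ideal R} (hrad : I.IsRadical) {Λ : Set (Ideal R)} (hΛ : Λ ⊆ I.minimalPrimes) :
    Submodule.colon I (sInf Λ : Ideal R) = sInf (I.minimalPrimes \ Λ) := by
  rw [Ideal.colon_eq_sInf_minimalPrimes hrad]
  congr 1
  ext p
  exact and_congr_right fun hp => not_congr (Ideal.sInf_le_minimalPrime_iff hΛ hp)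

/-- The intersection of a nonempty proper subset of the minimal primes of `I` is a proper
nonzero ideal. -/
theorem Ideal.sInf_ne_bot_and_ne_top {R : Type*} [CommRing R] [IsNoetherianRing R]
    {I : Ideal R} {Λ : Set (Ideal R)} (hΛ : Λ ⊆ I.minimalPrimes) (hne : Λ.Nonempty)
    (hdiff : (I.minimalPrimes \ Λ).Nonempty) : sInf Λ ≠ ⊥ ∧ sInf Λ ≠ ⊤ := by
  constructor
  · intro h
    obtain ⟨q, hq, hqΛ⟩ := hdiff
    exact hqΛ ((Ideal.sInf_le_minimalPrime_iff hΛ hq).mp (h ▸ bot_le))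
  · intro h
    obtain ⟨p, hp⟩ := hne
    exact (hΛ hp).1.1.ne_top (top_le_iff.mp (h ▸ sInf_le hp))

/-- If `I` is a radical ideal generated by an `R`-regular sequence, then an
ideal `a` is linked by `I` iff `a` is the intersection of a nonempty proper subset `Λ` of
`Ass_R(R/I)`; in that case `a` and `b := ⋂_{p ∈ Ass_R(R/I) \ Λ} p` are geometrically linked
by `I`. -/
theorem stmt_13 {R : Type*} [CommRing R] [IsNoetherianRing R] (I : Ideal R)
    (hI : I.IsGenByRegularSequence) (hrad : I.radical = I) (a : Ideal R) :
    ((∃ b : Ideal R, LinkedBy a b I) ↔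
      ∃ Λ ⊆ associatedPrimes R (R ⧸ I), Λ.Nonempty ∧
        Λ ≠ associatedPrimes R (R ⧸ I) ∧ a = sInf Λ) ∧
    (∀ Λ ⊆ associatedPrimes R (R ⧸ I), Λ.Nonempty →
      Λ ≠ associatedPrimes R (R ⧸ I) → a = sInf Λ →
        LinkedBy a (sInf (associatedPrimes R (R ⧸ I) \ Λ)) I ∧
          a ⊓ sInf (associatedPrimes R (R ⧸ I) \ Λ) = I) := by
  have hradI : I.IsRadical := Ideal.radical_eq_iff.mp hrad
  rw [Ideal.associatedPrimes_quotient_eq_minimalPrimes hradI]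
  have hlink : ∀ Λ ⊆ I.minimalPrimes, Λ.Nonempty → Λ ≠ I.minimalPrimes → a = sInf Λ →
      LinkedBy a (sInf (I.minimalPrimes \ Λ)) I ∧ a ⊓ sInf (I.minimalPrimes \ Λ) = I := by
    rintro Λ hΛ hne hproper rfl
    have hdiff : (I.minimalPrimes \ Λ).Nonempty :=
      Set.nonempty_of_ssubset (hΛ.ssubset_of_ne hproper)
    have hcompl : I.minimalPrimes \ (I.minimalPrimes \ Λ) = Λ := Set.sdiff_sdiff_cancel_left hΛ
    have hinf : sInf Λ ⊓ sInf (I.minimalPrimes \ Λ) = I := by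
      rw [← sInf_union, Set.union_sdiff_cancel hΛ, Ideal.sInf_minimalPrimes, hrad]
    obtain ⟨ha₀, ha₁⟩ := Ideal.sInf_ne_bot_and_ne_top hΛ hne hdiff
    obtain ⟨hb₀, hb₁⟩ := Ideal.sInf_ne_bot_and_ne_top (I := I) Set.sdiff_subset hdiff
      (hcompl.symm ▸ hne)
    refine ⟨⟨ha₀, ha₁, hb₀, hb₁, hinf.ge, hI, ?_, ?_⟩, hinf⟩
    · rw [Ideal.colon_sInf_eq_sInf_diff hradI Set.sdiff_subset, hcompl]
    · rw [Ideal.colon_sInf_eq_sInf_diff hradI hΛ]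
  refine ⟨⟨?_, ?_⟩, hlink⟩
  · rintro ⟨b, -, ha₁, -, hb₁, -, -, ha, hb⟩
    have ha' := ha.trans (Ideal.colon_eq_sInf_minimalPrimes hradI b)
    refine ⟨{p ∈ I.minimalPrimes | ¬ b ≤ p}, Set.sep_subset _ _, ?_, ?_, ha'⟩
    · rw [Set.nonempty_iff_ne_empty]
      intro h
      exact ha₁ (by rw [ha', h, sInf_empty])
    · intro h
      apply hb₁
      rw [hb, ha', h, Ideal.colon_sInf_eq_sInf_diff hradI subset_rfl, Set.sdiff_self, sInf_empty]
  · rintro ⟨Λ, hΛ, hne, hproper, ha⟩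
    exact ⟨_, (hlink Λ hΛ hne hproper ha).1⟩
end

section
/- Let R be a Cohen-Macaulay commutative Noetherian ring. Then every nonzero prime ideal of R is a linked ideal. -/
/-- The depth of a local ring `R`: the supremum of lengths of `R`-regular sequences contained
in the maximal ideal. -/
noncomputable def ringDepth (R : Type*) [CommRing R] [IsLocalRing R] : ℕ∞ :=
  sSup {n : ℕ∞ | ∃ rs : List R, (rs.length : ℕ∞) = n ∧
    (∀ x ∈ rs, x ∈ IsLocalRing.maximalIdeal R) ∧ RingTheory.Sequence.IsRegular R rs}

/-- A local ring is Cohen–Macaulay if its depth equals its Krull dimension. -/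
def IsCohenMacaulayLocalRing (R : Type*) [CommRing R] [IsLocalRing R] : Prop :=
  ringKrullDim R = (ringDepth R : WithBot ℕ∞)

/-- A ring is Cohen–Macaulay if its localization at every prime ideal is a Cohen–Macaulay
local ring. -/
def IsCohenMacaulayRing (R : Type*) [CommRing R] : Prop :=
  ∀ (p : Ideal R) (hp : p.IsPrime),
    letI := hp
    IsCohenMacaulayLocalRing (Localization.AtPrime p)

open CategoryTheory Abelian RingTheory.Sequence in
lemma subsingleton_linearMap_quotient_of_subsingleton_ext {R : Type*} [CommRing R]
    (N M : ModuleCat R) {rs : List R} (reg : IsWeaklyRegular M rs)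
    (h : ∀ i ≤ rs.length, Subsingleton (Ext N M i)) :
    Subsingleton (N →ₗ[R] M ⧸ (Ideal.ofList rs • ⊤ : Submodule R M)) := by
  induction rs generalizing M with
  | nil =>
    have := h 0 le_rfl
    have : Subsingleton (N →ₗ[R] M) :=
      (Ext.addEquiv₀.trans ModuleCat.homAddEquiv).symm.subsingleton
    exact (LinearEquiv.congrRight (M := N) (R := R)
      (Submodule.quotEquivOfEqBot (Ideal.ofList [] • ⊤ : Submodule R M)
        (by rw [Ideal.ofList_nil, Submodule.bot_smul]))).subsingleton
  | cons x rs ih =>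
    rw [isWeaklyRegular_cons_iff] at reg
    have := ih (ModuleCat.of R (QuotSMulTop x M)) reg.2 fun i hi ↦ by
      have zero₁ := AddCommGrpCat.isZero_of_iff_subsingleton.mpr (h i (by simp; omega))
      have zero₂ := AddCommGrpCat.isZero_of_iff_subsingleton.mpr (h (i + 1) (by simp; omega))
      exact AddCommGrpCat.subsingleton_of_isZero <| ShortComplex.Exact.isZero_of_both_zeros
        ((Ext.covariant_sequence_exact₃' N reg.1.smulShortComplex_shortExact) i (i + 1) rfl)
        (zero₁.eq_zero_of_src _) (zero₂.eq_zero_of_tgt _)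
    exact (LinearEquiv.congrRight (M := N) (R := R)
      (Submodule.quotOfListConsSMulTopEquivQuotSMulTopInner M x rs)).subsingleton

open RingTheory.Sequence in
/-- If the maximal ideal annihilates a nonzero element modulo a regular sequence, then that sequence
has the largest possible length. -/
lemma ringDepth_le_length_of_isRegular {A : Type*} [CommRing A] [IsLocalRing A] [IsNoetherianRing A]
    {rs : List A} (reg : IsRegular A rs) {y : A} (hy : y ∉ Ideal.ofList rs)
    (hm : ∀ r ∈ IsLocalRing.maximalIdeal A, r * y ∈ Ideal.ofList rs) :
    ringDepth A ≤ rs.length := by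
  refine sSup_le ?_
  rintro _ ⟨ss, rfl, mem, hss⟩
  by_contra! hlt
  rw [Nat.cast_lt] at hlt
  set m := IsLocalRing.maximalIdeal A
  have hsupp : Module.support A (A ⧸ m) ⊆ PrimeSpectrum.zeroLocus m := by
    rw [Module.support_eq_zeroLocus, Ideal.annihilator_quotient]
  have hlt' : m • (⊤ : Submodule A A) < ⊤ := by
    simpa using (Ideal.IsPrime.ne_top inferInstance : m ≠ ⊤).lt_top
  have hext := ModuleCat.subsingleton_ext_of_exists_isRegular m (ModuleCat.of A (A ⧸ m)) hsupp
    (ModuleCat.of A A) hlt' ss mem hss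
  have hsub := subsingleton_linearMap_quotient_of_subsingleton_ext (ModuleCat.of A (A ⧸ m))
    (ModuleCat.of A A) reg.toIsWeaklyRegular fun i hi ↦ hext i (by omega)
  let f : (A ⧸ m) →ₗ[A] A ⧸ (Ideal.ofList rs • ⊤ : Submodule A A) :=
    m.liftQ (LinearMap.toSpanSingleton A _ (Submodule.Quotient.mk y)) fun r hr ↦ by
      rw [LinearMap.mem_ker, LinearMap.toSpanSingleton_apply, ← Submodule.Quotient.mk_smul,
        Submodule.Quotient.mk_eq_zero]
      simpa using hm r hr
  have hf : f (Submodule.Quotient.mk 1) = 0 := by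
    rw [show f = 0 from hsub.elim f 0, LinearMap.zero_apply]
  rw [Submodule.liftQ_apply, LinearMap.toSpanSingleton_apply, one_smul,
    Submodule.Quotient.mk_eq_zero] at hf
  exact hy (by simpa using hf)

open RingTheory.Sequence in
lemma length_le_height_of_isWeaklyRegular {R : Type*} [CommRing R] [IsNoetherianRing R]
    {p : Ideal R} [p.IsPrime] {rs : List R} (reg : IsWeaklyRegular R rs) (mem : ∀ r ∈ rs, r ∈ p) :
    (rs.length : ℕ∞) ≤ p.height := by
  have hreg := reg.isRegular_of_isLocalization_of_mem (Localization.AtPrime p) p mem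
  have hdim := ringKrullDim_add_length_eq_ringKrullDim_of_isRegular _ hreg
  rw [IsLocalization.AtPrime.ringKrullDim_eq_height p (Localization.AtPrime p),
    List.length_map] at hdim
  have : Nontrivial (Localization.AtPrime p ⧸
      Ideal.ofList (rs.map (algebraMap R (Localization.AtPrime p)))) :=
    Ideal.Quotient.nontrivial_iff.mpr fun h ↦ hreg.top_ne_smul (by simp [h])
  have h0 := ringKrullDim_nonneg_of_nontrivial (R := Localization.AtPrime p ⧸
    Ideal.ofList (rs.map (algebraMap R (Localization.AtPrime p))))
  rw [← WithBot.coe_le_coe, ← hdim]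
  exact le_add_of_nonneg_left h0

open RingTheory.Sequence in
lemma IsCohenMacaulayRing.height_le_length {R : Type*} [CommRing R] [IsNoetherianRing R]
    (hCM : IsCohenMacaulayRing R) {q : Ideal R} [hq : q.IsPrime] {rs : List R}
    (reg : IsWeaklyRegular R rs) (mem : ∀ r ∈ rs, r ∈ q) {y : R}
    (hy : ∀ r, r ∈ q ↔ r * y ∈ Ideal.ofList rs) :
    q.height ≤ rs.length := by
  have hdim : ringKrullDim (Localization.AtPrime q) = (ringDepth (Localization.AtPrime q) : _) :=
    hCM q hq
  rw [IsLocalization.AtPrime.ringKrullDim_eq_height q (Localization.AtPrime q),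
    WithBot.coe_inj] at hdim
  rw [hdim]
  have hreg := reg.isRegular_of_isLocalization_of_mem (Localization.AtPrime q) q mem
  rw [← List.length_map (as := rs) (algebraMap R (Localization.AtPrime q))]
  refine ringDepth_le_length_of_isRegular hreg (y := algebraMap R _ y) ?_ ?_
  · rw [← Ideal.map_ofList, IsLocalization.algebraMap_mem_map_algebraMap_iff q.primeCompl]
    rintro ⟨s, hs, hsy⟩
    exact hs ((hy s).mpr hsy)
  · intro r hr
    rw [← Localization.AtPrime.map_eq_maximalIdeal] at hr
    rw [← Ideal.map_ofList]
    have hle : Ideal.map (algebraMap R (Localization.AtPrime q)) q ≤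
        Submodule.colon (Ideal.map (algebraMap R (Localization.AtPrime q)) (Ideal.ofList rs))
          {algebraMap R _ y} := by
      rw [Ideal.map_le_iff_le_comap]
      intro a ha
      rw [Ideal.mem_comap, Submodule.mem_colon_singleton, smul_eq_mul, ← map_mul]
      exact Ideal.mem_map_of_mem _ ((hy a).mp ha)
    simpa using hle hr

open RingTheory.Sequence in
lemma Ideal.IsPrime.isRegular_of_isWeaklyRegular {R : Type*} [CommRing R] {p : Ideal R}
    (hp : p.IsPrime) {rs : List R} (reg : IsWeaklyRegular R rs) (mem : ∀ r ∈ rs, r ∈ p) :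
    IsRegular R rs := by
  refine ⟨reg, fun h ↦ hp.ne_top (top_le_iff.mp ?_)⟩
  have hle : Ideal.ofList rs ≤ p := Ideal.span_le.mpr mem
  rw [h]
  simpa using hle

open RingTheory.Sequence in
/-- Every prime ideal `p` of a Noetherian ring contains a regular sequence that is maximal among the
regular sequences in `p`; then `p` lies in a prime of the form `(rs) : y`. -/
lemma exists_isWeaklyRegular_le_colon {R : Type*} [CommRing R] [IsNoetherianRing R]
    (p : Ideal R) [p.IsPrime] :
    ∃ (rs : List R) (q : Ideal R) (y : R), IsWeaklyRegular R rs ∧ (∀ r ∈ rs, r ∈ p) ∧ q.IsPrime ∧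
      p ≤ q ∧ ∀ r, r ∈ q ↔ r * y ∈ Ideal.ofList rs := by
  let P : ℕ → Prop := fun n ↦ ∃ rs : List R, rs.length = n ∧ IsWeaklyRegular R rs ∧ ∀ r ∈ rs, r ∈ p
  obtain ⟨N, hN⟩ := ENat.ne_top_iff_exists.mp (Ideal.height_ne_top (I := p) (Ideal.IsPrime.ne_top'))
  have hbdd : ∀ n, P n → n ≤ N := by
    rintro _ ⟨rs, rfl, reg, mem⟩
    have := length_le_height_of_isWeaklyRegular reg mem
    rw [← hN] at this
    exact_mod_cast this
  classical
  have hP0 : P 0 := ⟨[], rfl, IsWeaklyRegular.nil R R, by simp⟩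
  obtain ⟨rs, hlen, reg, mem⟩ : P (Nat.findGreatest P N) :=
    Nat.findGreatest_spec (Nat.zero_le _) hP0
  have hmax : ∀ r ∈ p, ¬ IsSMulRegular (R ⧸ (Ideal.ofList rs • ⊤ : Submodule R R)) r := by
    intro r hr hreg
    have hP : P (rs.length + 1) := ⟨rs ++ [r], by simp,
      (isWeaklyRegular_append_iff R rs [r]).mpr ⟨reg, (isWeaklyRegular_singleton_iff _ r).mpr hreg⟩,
      by simpa [or_imp, forall_and] using ⟨mem, hr⟩⟩
    have := Nat.le_findGreatest (hbdd _ hP) hP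
    omega
  obtain ⟨q, hq, hle⟩ :
      ∃ q ∈ associatedPrimes R (R ⧸ (Ideal.ofList rs • ⊤ : Submodule R R)), p ≤ q := by
    refine (p.subset_union_prime_finite (associatedPrimes.finite ..) (f := id) 0 0
      fun _ h _ _ ↦ h.1).1 ?_
    intro r hr
    simp only [id]
    rw [biUnion_associatedPrimes_eq_zero_divisors]
    have := hmax r hr
    rw [isSMulRegular_iff_right_eq_zero_of_smul] at this
    push Not at this
    obtain ⟨x, hx, hx0⟩ := this
    exact ⟨x, hx0, hx⟩
  obtain ⟨hqp, x, hx⟩ := isAssociatedPrime_iff.mp hq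
  obtain ⟨y, rfl⟩ := Submodule.Quotient.mk_surjective _ x
  refine ⟨rs, q, y, reg, mem, hqp, hle, fun r ↦ ?_⟩
  rw [hx, Submodule.mem_colon_singleton, ← Submodule.Quotient.mk_smul, Submodule.mem_bot,
    Submodule.Quotient.mk_eq_zero]
  simp

lemma IsLinkedIdeal.of_forall_mem_iff {R : Type*} [CommRing R] {p I : Ideal R} (hp : p.IsPrime)
    (hp0 : p ≠ ⊥) (hI : Ideal.IsGenByRegularSequence I) (hlt : I < p) {y : R}
    (hy : ∀ r, r ∈ p ↔ r * y ∈ I) : IsLinkedIdeal p := by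
  have hyI : y ∉ I := fun h ↦ hp.one_notMem ((hy 1).mpr (by simpa using h))
  have hyb : y ∈ Submodule.colon I (p : Set R) := Submodule.mem_colon.mpr fun r hr ↦ by
    simpa [mul_comm] using (hy r).mp hr
  have hIb : I ≤ Submodule.colon I (p : Set R) := fun a ha ↦
    Submodule.mem_colon.mpr fun r _ ↦ I.mul_mem_right r ha
  refine ⟨I, Submodule.colon I p, hp0, hp.ne_top, ?_, ?_, le_inf hlt.le hIb, hI, ?_, rfl⟩
  · intro h
    rw [h, Ideal.mem_bot] at hyb
    exact hyI (hyb ▸ I.zero_mem)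
  · intro h
    refine hlt.not_ge fun r hr ↦ ?_
    simpa using Submodule.mem_colon.mp (h ▸ Submodule.mem_top : (1 : R) ∈ Submodule.colon I p) r hr
  · refine le_antisymm (fun r hr ↦ Submodule.mem_colon.mpr fun s hs ↦ ?_) fun r hr ↦ ?_
    · simpa [mul_comm] using Submodule.mem_colon.mp hs r hr
    · exact (hy r).mpr (by simpa using Submodule.mem_colon.mp hr y hyb)

open RingTheory.Sequence in
/-- A nonzero prime ideal `p` generated by a regular sequence is linked by the ideal obtained by
squaring the last term `x` of the sequence, whose colon by `x` is `p`. -/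
lemma IsLinkedIdeal.of_eq_ofList {R : Type*} [CommRing R] {p : Ideal R} (hp : p.IsPrime)
    (hp0 : p ≠ ⊥) {rs : List R} (reg : IsWeaklyRegular R rs) (hrs : p = Ideal.ofList rs) :
    IsLinkedIdeal p := by
  obtain rfl | ⟨l, x, rfl⟩ := rs.eq_nil_or_concat'
  · exact absurd (by simpa using hrs) hp0
  rw [isWeaklyRegular_append_iff, isWeaklyRegular_singleton_iff] at reg
  have hreg : IsWeaklyRegular R (l ++ [x ^ 2]) := by
    rw [isWeaklyRegular_append_iff, isWeaklyRegular_singleton_iff]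
    exact ⟨reg.1, reg.2.pow 2⟩
  rw [Ideal.ofList_append, Ideal.ofList_singleton] at hrs
  have hlp : Ideal.ofList l ≤ p := hrs ▸ le_sup_left
  have hxp : x ∈ p := hrs ▸ Ideal.mem_sup_right (Ideal.mem_span_singleton_self x)
  have hcancel : ∀ a, x * a ∈ Ideal.ofList l → a ∈ Ideal.ofList l := fun a ha ↦ by
    have := isSMulRegular_iff_right_eq_zero_of_smul.mp reg.2 (Submodule.Quotient.mk a)
    rw [← Submodule.Quotient.mk_smul, Submodule.Quotient.mk_eq_zero,
      Submodule.Quotient.mk_eq_zero] at this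
    simpa using this (by simpa using ha)
  have hmem : ∀ r ∈ l ++ [x ^ 2], r ∈ p := by
    intro r hr
    rcases List.mem_append.mp hr with hr | hr
    · exact hlp (Ideal.subset_span hr)
    · rw [List.mem_singleton.mp hr]
      exact p.pow_mem_of_mem hxp 2 two_pos
  have hy : ∀ r, r ∈ p ↔ r * x ∈ Ideal.ofList (l ++ [x ^ 2]) := by
    intro r
    rw [Ideal.ofList_append, Ideal.ofList_singleton, sup_comm, Ideal.mem_span_singleton_sup]
    constructor
    · intro hr
      rw [hrs, sup_comm, Ideal.mem_span_singleton_sup] at hr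
      obtain ⟨a, b, hb, rfl⟩ := hr
      exact ⟨a, b * x, Ideal.mul_mem_right _ _ hb, by ring⟩
    · rintro ⟨c, j, hj, h⟩
      have := hcancel (r - c * x) (by convert hj using 1; linear_combination -h)
      simpa using p.add_mem (hlp this) (p.mul_mem_left c hxp)
  refine .of_forall_mem_iff hp hp0 ⟨_, hp.isRegular_of_isWeaklyRegular hreg hmem, rfl⟩
    (lt_of_le_of_ne (Ideal.span_le.mpr hmem) fun h ↦ hp.one_notMem ?_) hy
  rw [hy, one_mul, h]
  exact hxp

/-- In a Cohen–Macaulay Noetherian ring, every nonzero prime ideal is a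
linked ideal. -/
theorem stmt_14 {R : Type*} [CommRing R] [IsNoetherianRing R] (hCM : IsCohenMacaulayRing R) :
    ∀ p : Ideal R, p.IsPrime → p ≠ ⊥ → IsLinkedIdeal p := by
  intro p hp hp0
  obtain ⟨rs, q, y, reg, mem, hq, hpq, hy⟩ := exists_isWeaklyRegular_le_colon p
  have hle := hCM.height_le_length reg (fun r hr ↦ hpq (mem r hr)) hy
  obtain rfl : p = q := by
    by_contra hne
    have := Ideal.height_strict_mono_of_isPrime (lt_of_le_of_ne hpq hne)
    exact (this.trans_le hle).not_ge (length_le_height_of_isWeaklyRegular reg mem)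
  have hIp : Ideal.ofList rs ≤ p := Ideal.span_le.mpr mem
  rcases hIp.lt_or_eq with hlt | heq
  · exact .of_forall_mem_iff hp hp0 ⟨rs, hp.isRegular_of_isWeaklyRegular reg mem, rfl⟩ hlt hy
  · exact .of_eq_ofList hp hp0 reg heq.symm
end

section
/- Let R be a Cohen-Macaulay commutative Noetherian ring and let p₁ and p₂ be prime ideals of R with p₁ ∩ p₂ ≠ 0 and ht p₁ = ht p₂. Then p₁ ∩ p₂ is a linked ideal. -/
open RingTheory.Sequence IsLocalRing CategoryTheory Abelian
open scoped Pointwise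

universe u

section Depth

variable {A : Type u} [CommRing A] [IsNoetherianRing A] [IsLocalRing A]

/-- Dividing out by a regular element lowers the depth of a module by at most one. -/
theorem exists_isRegular_quotSMulTop {M : Type u} [AddCommGroup M] [Module A M]
    [Module.Finite A M] {x : A} (hx : x ∈ maximalIdeal A) (hreg : IsSMulRegular M x)
    {ys : List A} {n : ℕ} (hlen : ys.length = n + 1) (hmem : ∀ y ∈ ys, y ∈ maximalIdeal A)
    (hys : IsRegular M ys) :
    ∃ zs : List A, zs.length = n ∧ (∀ z ∈ zs, z ∈ maximalIdeal A) ∧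
      IsRegular (QuotSMulTop x M) zs := by
  have hM : Nontrivial M := hys.nontrivial
  have hlt {L : Type u} [AddCommGroup L] [Module A L] [Module.Finite A L] [Nontrivial L] :
      maximalIdeal A • (⊤ : Submodule A L) < ⊤ :=
    (Submodule.top_ne_ideal_smul_of_le_jacobson_annihilator
      (maximalIdeal_le_jacobson _)).symm.lt_top
  have : Nontrivial (QuotSMulTop x M) := nontrivial_quotSMulTop_of_mem_maximalIdeal M hx
  let N := ModuleCat.of A (Shrink.{u} (A ⧸ maximalIdeal A))
  have hext : ∀ i < n + 1, Subsingleton (Ext N (ModuleCat.of A M) i) :=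
    ((ModuleCat.exists_isRegular_tfae (maximalIdeal A) (n + 1) (ModuleCat.of A M) hlt).out 3 1
      rfl rfl).mp ⟨ys, hlen, hmem, hys⟩
  refine ((ModuleCat.exists_isRegular_tfae (maximalIdeal A) n
    (ModuleCat.of A (QuotSMulTop x M)) hlt).out 1 3 rfl rfl).mp fun i hi ↦ ?_
  have zero₁ := AddCommGrpCat.isZero_of_iff_subsingleton.mpr (hext i (by lia))
  have zero₂ := AddCommGrpCat.isZero_of_iff_subsingleton.mpr (hext (i + 1) (by lia))
  have hreg' : IsSMulRegular (ModuleCat.of A M) x := hreg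
  exact AddCommGrpCat.subsingleton_of_isZero <| ShortComplex.Exact.isZero_of_both_zeros
    ((Ext.covariant_sequence_exact₃' N hreg'.smulShortComplex_shortExact) i (i + 1) rfl)
    (zero₁.eq_zero_of_src _) (zero₂.eq_zero_of_tgt _)

/-- A regular sequence which is shorter than some other regular sequence can be extended. -/
theorem exists_isSMulRegular_of_length_lt {M : Type u} [AddCommGroup M] [Module A M]
    [Module.Finite A M] {xs ys : List A} (hxs_mem : ∀ x ∈ xs, x ∈ maximalIdeal A)
    (hxs : IsWeaklyRegular M xs) (hys_mem : ∀ y ∈ ys, y ∈ maximalIdeal A)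
    (hys : IsRegular M ys) (hlt : xs.length < ys.length) :
    ∃ z ∈ maximalIdeal A, IsSMulRegular (M ⧸ (Ideal.ofList xs • ⊤ : Submodule A M)) z := by
  induction xs generalizing M ys with
  | nil =>
    match ys with
    | [] => simp at hlt
    | y :: ys =>
      refine ⟨y, hys_mem y (by simp), ?_⟩
      have e : (M ⧸ (Ideal.ofList [] • ⊤ : Submodule A M)) ≃ₗ[A] M :=
        Submodule.quotEquivOfEqBot _ (by
        rw [Ideal.ofList_nil (R := A), Submodule.bot_smul])
      exact (e.isSMulRegular_congr y).mpr ((isRegular_cons_iff M y ys).mp hys).1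
  | cons x xs ih =>
    rw [isWeaklyRegular_cons_iff] at hxs
    obtain ⟨n, hn⟩ : ∃ n, ys.length = n + 1 := ⟨ys.length - 1, by lia⟩
    obtain ⟨zs, hlen, hzs_mem, hzs⟩ :=
      exists_isRegular_quotSMulTop (hxs_mem x (by simp)) hxs.1 hn hys_mem hys
    obtain ⟨z, hz, hreg⟩ := ih (fun w hw ↦ hxs_mem w (by simp [hw])) hxs.2 hzs_mem hzs
      (by simp at hlt; lia)
    exact ⟨z, hz, ((Submodule.quotOfListConsSMulTopEquivQuotSMulTopInner M x
      xs).isSMulRegular_congr z).mpr hreg⟩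

end Depth

section CohenMacaulay

variable {R : Type u} [CommRing R] [IsNoetherianRing R]

/-- In a Cohen–Macaulay ring, a weakly regular sequence in a prime `q` of length less than the
height of `q` can be extended, so `q` is not associated to it. -/
theorem IsCohenMacaulayRing.notMem_associatedPrimes (hCM : IsCohenMacaulayRing R)
    {q : Ideal R} [hq : q.IsPrime] {xs : List R} (hmem : ∀ x ∈ xs, x ∈ q)
    (hxs : IsWeaklyRegular R xs) (hlt : (xs.length : ℕ∞) < q.height) :
    q ∉ associatedPrimes R (R ⧸ (Ideal.ofList xs • ⊤ : Ideal R)) := by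
  intro hass
  obtain ⟨-, u, hu⟩ := isAssociatedPrime_iff.mp hass
  obtain ⟨u, rfl⟩ := Submodule.Quotient.mk_surjective _ u
  have hq_iff (r : R) : r ∈ q ↔ r * u ∈ Ideal.ofList xs := by
    rw [hu, Submodule.mem_colon_singleton, Submodule.mem_bot, ← Submodule.Quotient.mk_smul,
      Submodule.Quotient.mk_eq_zero]
    simp
  let Rq := Localization.AtPrime q
  have hdepth : q.height = ringDepth Rq := by
    have h := hCM q hq
    rw [IsCohenMacaulayLocalRing, IsLocalization.AtPrime.ringKrullDim_eq_height q] at h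
    exact_mod_cast h
  rw [hdepth, ringDepth, lt_sSup_iff] at hlt
  obtain ⟨_, ⟨ys, rfl, hys_mem, hys⟩, hlt⟩ := hlt
  have hxs' : IsRegular Rq (xs.map (algebraMap R Rq)) :=
    hxs.isRegular_of_isLocalization_of_mem Rq q hmem
  obtain ⟨z, hz, hreg⟩ := exists_isSMulRegular_of_length_lt (M := Rq)
    (xs := xs.map (algebraMap R Rq)) (by
      intro x hx
      obtain ⟨r, hr, rfl⟩ := List.mem_map.mp hx
      exact (IsLocalization.AtPrime.to_map_mem_maximal_iff Rq q r).mpr (hmem r hr))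
    hxs'.toIsWeaklyRegular hys_mem hys (by simpa using hlt)
  obtain ⟨r, s, rfl⟩ := IsLocalization.exists_mk'_eq q.primeCompl z
  have hr : r ∈ q := (IsLocalization.AtPrime.mk'_mem_maximal_iff Rq q r s).mp hz
  have hu_mem : algebraMap R Rq u ∈ (Ideal.ofList xs).map (algebraMap R Rq) := by
    have h := mem_of_isSMulRegular_quotient_of_smul_mem hreg (x := algebraMap R Rq u) (by
      have := Ideal.mul_mem_left _ (IsLocalization.mk' Rq 1 s)
        (Ideal.mem_map_of_mem (algebraMap R Rq) ((hq_iff r).mp hr))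
      rw [map_mul, ← mul_assoc, mul_comm (IsLocalization.mk' Rq 1 s),
        ← IsLocalization.mk'_eq_mul_mk'_one] at this
      simpa [Ideal.map_ofList] using this)
    simpa [Ideal.map_ofList] using h
  obtain ⟨t, ht, htu⟩ :=
    (IsLocalization.algebraMap_mem_map_algebraMap_iff q.primeCompl Rq _ _).mp hu_mem
  exact ht ((hq_iff t).mpr htu)

/-- The length of a weakly regular sequence in a prime is at most its height. -/
theorem RingTheory.Sequence.IsWeaklyRegular.length_le_height {q : Ideal R} [q.IsPrime]
    {xs : List R} (hxs : IsWeaklyRegular R xs) (hmem : ∀ x ∈ xs, x ∈ q) :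
    (xs.length : ℕ∞) ≤ q.height := by
  let Rq := Localization.AtPrime q
  have hxs' : IsRegular Rq (xs.map (algebraMap R Rq)) :=
    hxs.isRegular_of_isLocalization_of_mem Rq q hmem
  have hdim := ringKrullDim_add_length_eq_ringKrullDim_of_isRegular _ hxs'
  rw [IsLocalization.AtPrime.ringKrullDim_eq_height q Rq, List.length_map] at hdim
  have hnt : Nontrivial (Rq ⧸ Ideal.ofList (xs.map (algebraMap R Rq))) := by
    have := hxs'.top_ne_smul
    exact Ideal.Quotient.nontrivial_iff.mpr (by simpa using this.symm)
  have h : ((xs.length : ℕ∞) : WithBot ℕ∞) ≤ (q.height : WithBot ℕ∞) := by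
    rw [← hdim]
    exact le_add_of_nonneg_left ringKrullDim_nonneg_of_nontrivial
  exact_mod_cast h

/-- A prime is minimal over a weakly regular sequence it contains whose length is its height. -/
theorem RingTheory.Sequence.IsWeaklyRegular.mem_minimalPrimes {p : Ideal R} [p.IsPrime]
    {xs : List R} (hxs : IsWeaklyRegular R xs) (hmem : ∀ x ∈ xs, x ∈ p)
    (hlen : (xs.length : ℕ∞) = p.height) : p ∈ (Ideal.ofList xs).minimalPrimes := by
  obtain ⟨q, hq, hqp⟩ := Ideal.exists_minimalPrimes_le (Ideal.span_le.mpr hmem)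
  have := hq.isPrime
  have hle := hxs.length_le_height fun x hx ↦ hq.1.2 (Ideal.subset_span hx)
  have h := Ideal.eq_of_le_of_height_le q hqp (hlen ▸ hle)
  rwa [← h]

/-- In a Cohen–Macaulay ring, the intersection of two primes of the same height contains weakly
regular sequences of every length up to this height. -/
theorem IsCohenMacaulayRing.exists_isWeaklyRegular_inf (hCM : IsCohenMacaulayRing R)
    {p₁ p₂ : Ideal R} [p₁.IsPrime] [p₂.IsPrime] (hht : p₁.height = p₂.height) (n : ℕ)
    (hn : (n : ℕ∞) ≤ p₁.height) :
    ∃ xs : List R, xs.length = n ∧ (∀ x ∈ xs, x ∈ p₁ ⊓ p₂) ∧ IsWeaklyRegular R xs := by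
  induction n with
  | zero => exact ⟨[], by simp⟩
  | succ n ih =>
    have hn' : (n : ℕ∞) < p₁.height := lt_of_lt_of_le (by exact_mod_cast n.lt_succ_self) hn
    obtain ⟨xs, hlen, hmem, hxs⟩ := ih hn'.le
    obtain ⟨x, hx, hreg⟩ : ∃ x ∈ p₁ ⊓ p₂,
        IsSMulRegular (R ⧸ (Ideal.ofList xs • ⊤ : Ideal R)) x := by
      by_contra! h
      obtain ⟨q, hass, hle⟩ := (Ideal.subset_union_prime_finite
        (associatedPrimes.finite R (R ⧸ (Ideal.ofList xs • ⊤ : Ideal R))) (f := id) 0 0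
        (fun _ h _ _ ↦ h.1) (I := p₁ ⊓ p₂)).mp (by
          have := biUnion_associatedPrimes_eq_compl_regular R
            (M := R ⧸ (Ideal.ofList xs • ⊤ : Ideal R))
          simp only [id]
          rw [this]
          exact h)
      have hq : q.IsPrime := hass.isPrime
      rw [id] at hle
      refine hCM.notMem_associatedPrimes (fun x hx ↦ hle (hmem x hx)) hxs ?_ hass
      rw [hlen]
      rcases hq.inf_le.mp hle with h | h
      · exact hn'.trans_le (Ideal.height_mono h)
      · exact (hht ▸ hn').trans_le (Ideal.height_mono h)
    refine ⟨xs ++ [x], by simp [hlen], ?_, ?_⟩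
    · intro y hy
      rcases List.mem_append.mp hy with h | h
      · exact hmem y h
      · rwa [List.mem_singleton.mp h]
    · rw [isWeaklyRegular_append_iff, isWeaklyRegular_singleton_iff]
      exact ⟨hxs, hreg⟩

end CohenMacaulay

/-- A weakly regular sequence in a proper nonzero ideal can be modified, keeping its length, so
that it does not generate the ideal. -/
theorem RingTheory.Sequence.IsWeaklyRegular.exists_not_le_ofList {R : Type*} [CommRing R]
    {a : Ideal R} (hbot : a ≠ ⊥) (htop : a ≠ ⊤) {xs : List R} (hxs : IsWeaklyRegular R xs)
    (hmem : ∀ x ∈ xs, x ∈ a) :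
    ∃ ys : List R, ys.length = xs.length ∧ (∀ y ∈ ys, y ∈ a) ∧ IsWeaklyRegular R ys ∧
      ¬ a ≤ Ideal.ofList ys := by
  rcases List.eq_nil_or_concat' xs with rfl | ⟨ws, x, rfl⟩
  · exact ⟨[], by simp [hbot]⟩
  rw [isWeaklyRegular_append_iff, isWeaklyRegular_singleton_iff] at hxs
  have hx : x ∈ a := hmem x (by simp)
  have hws : Ideal.ofList ws ≤ a := Ideal.span_le.mpr fun w hw ↦ hmem w (List.mem_append_left _ hw)
  refine ⟨ws ++ [x ^ 2], by simp, ?_, ?_, fun hle ↦ htop ?_⟩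
  · intro y hy
    rcases List.mem_append.mp hy with h | h
    · exact hmem y (by simp [h])
    · rw [List.mem_singleton.mp h]
      exact a.pow_mem_of_mem hx 2 two_pos
  · rw [isWeaklyRegular_append_iff, isWeaklyRegular_singleton_iff]
    exact ⟨hxs.1, hxs.2.pow 2⟩
  · have h := hle hx
    rw [Ideal.ofList_append, Ideal.ofList_singleton, Submodule.mem_sup] at h
    obtain ⟨i, hi, j, hj, hij⟩ := h
    obtain ⟨r, rfl⟩ := Ideal.mem_span_singleton'.mp hj
    have hone : 1 - r * x ∈ Ideal.ofList ws := by
      have := mem_of_isSMulRegular_quotient_of_smul_mem hxs.2 (x := 1 - r * x) (by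
        have : x • (1 - r * x) = i := by
          rw [smul_eq_mul]
          linear_combination -hij
        rw [this]; simpa using hi)
      simpa using this
    rw [Ideal.eq_top_iff_one]
    simpa using a.add_mem (hws hone) (a.mul_mem_left r hx)

/-- In a Cohen–Macaulay Noetherian ring, the intersection of two prime ideals
of the same height is a linked ideal provided it is nonzero. -/
theorem stmt_15 {R : Type*} [CommRing R] [IsNoetherianRing R] (hCM : IsCohenMacaulayRing R)
    (p₁ p₂ : PrimeSpectrum R) (hne : p₁.asIdeal ⊓ p₂.asIdeal ≠ ⊥)
    (hht : Order.height p₁ = Order.height p₂) :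
    IsLinkedIdeal (p₁.asIdeal ⊓ p₂.asIdeal) := by
  rw [← PrimeSpectrum.height_eq_orderHeight, ← PrimeSpectrum.height_eq_orderHeight] at hht
  obtain ⟨p₁, hp₁⟩ := p₁
  obtain ⟨p₂, hp₂⟩ := p₂
  dsimp only at hne hht ⊢
  have htop : p₁ ⊓ p₂ ≠ ⊤ := fun h ↦ hp₁.ne_top (top_le_iff.mp (h ▸ inf_le_left))
  obtain ⟨n, hn⟩ := ENat.ne_top_iff_exists.mp (Ideal.height_ne_top_of_isPrime (I := p₁))
  obtain ⟨ws, hws_len, hws_mem, hws⟩ := hCM.exists_isWeaklyRegular_inf hht n hn.le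
  obtain ⟨xs, hlen, hmem, hxs, hnle⟩ := hws.exists_not_le_ofList hne htop hws_mem
  rw [hws_len] at hlen
  set I := Ideal.ofList xs with hI
  have hIle : I ≤ p₁ ⊓ p₂ := Ideal.span_le.mpr hmem
  have exists_colon {p : Ideal R} (hp : p ∈ I.minimalPrimes) :
      ∃ x : R, p = Submodule.colon I {x} :=
    Submodule.exists_eq_colon_of_mem_minimalPrimes (x := 1) (by
      rwa [show Submodule.colon I {(1 : R)} = I by ext; simp])
  obtain ⟨x, hx⟩ := exists_colon (hxs.mem_minimalPrimes (fun y hy ↦ (hmem y hy).1)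
    (hlen ▸ hn))
  obtain ⟨y, hy⟩ := exists_colon (hxs.mem_minimalPrimes (fun y hy ↦ (hmem y hy).2)
    (hlen ▸ hn.trans hht))
  have hcolon : p₁ ⊓ p₂ = Submodule.colon I ({x} ∪ {y} : Set R) := by
    rw [Submodule.colon_union, ← hx, ← hy]
  have hdouble : p₁ ⊓ p₂ = Submodule.colon I (Submodule.colon I (p₁ ⊓ p₂ : Ideal R) : Set R) := by
    refine le_antisymm (fun r hr ↦ Submodule.mem_colon.mpr fun s hs ↦ ?_) ?_
    · have := Submodule.mem_colon.mp hs r hr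
      rwa [smul_eq_mul, mul_comm]
    · conv_rhs => rw [hcolon]
      refine Submodule.colon_mono le_rfl fun z hz ↦ Submodule.mem_colon.mpr fun s hs ↦ ?_
      rw [SetLike.mem_coe, hcolon] at hs
      have := Submodule.mem_colon.mp hs z hz
      rwa [smul_eq_mul, mul_comm]
  refine ⟨I, Submodule.colon I (p₁ ⊓ p₂ : Ideal R), hne, htop, fun h ↦ htop ?_, fun h ↦ hnle ?_,
    le_inf hIle Ideal.le_colon, ⟨xs, ⟨hxs, ?_⟩, hI⟩, hdouble, rfl⟩
  · rw [hdouble, h, Submodule.colon_bot]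
  · exact (Submodule.colon_eq_top_iff_subset _).mp h
  · intro h
    rw [← hI, smul_eq_mul, Ideal.mul_top] at h
    exact htop (top_le_iff.mp (h.trans_le hIle))
end

section
/- Let (R, m) be a commutative Noetherian local ring. Then R is Gorenstein if and only if every nonzero proper unmixed ideal a of R is linked by every ideal (x₁,...,x_t) generated by an R-regular sequence x₁,...,x_t contained in a of length t = grade a with (x₁,...,x_t) ≠ a; that is, (x₁,...,x_t) :_R ((x₁,...,x_t) :_R a) = a for every such regular sequence. -/
universe u

/-- The grade of an ideal `a`: the supremum of lengths of `R`-regular sequences contained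
in `a` (for a Noetherian ring and proper `a`, the length of a maximal `R`-regular sequence
in `a`). -/
noncomputable def gradeIdeal {R : Type*} [CommRing R] (a : Ideal R) : ℕ∞ :=
  sSup {n : ℕ∞ | ∃ rs : List R, (rs.length : ℕ∞) = n ∧
    RingTheory.Sequence.IsRegular R rs ∧ ∀ x ∈ rs, x ∈ a}

/-- `R` is a Gorenstein ring: `R` has finite injective dimension as a module over itself,
i.e. there is `n` such that `Ext^i(N, R) = 0` for all modules `N` and all `i > n`. -/
def IsGorensteinRing (R : Type u) [CommRing R] : Prop :=
  ∃ n : ℕ, ∀ (N : ModuleCat.{u} R) (i : ℕ), n < i →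
    Subsingleton (((Ext R (ModuleCat.{u} R) i).obj (Opposite.op N)).obj (ModuleCat.of R R))

section

open CategoryTheory Abelian IsLocalRing Submodule RingTheory.Sequence

theorem subsingleton_ext_obj_iff {R : Type u} [CommRing R] (N M : ModuleCat.{u} R) (n : ℕ) :
    Subsingleton (((_root_.Ext R (ModuleCat.{u} R) (n + 1)).obj (Opposite.op N)).obj M) ↔
      Subsingleton (Abelian.Ext N M (n + 1)) := by
  let P := projectiveResolution N
  rw [← ModuleCat.isZero_iff_subsingleton, (P.isoExt (R := R) (n + 1) M).isZero_iff,
    ← HomologicalComplex.exactAt_iff_isZero_homology,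
    HomologicalComplex.exactAt_iff' _ n (n + 1) (n + 2) (by simp) (by simp),
    ShortComplex.moduleCat_exact_iff]
  constructor
  · intro h
    refine subsingleton_of_forall_eq 0 fun α => ?_
    obtain ⟨f, hf, rfl⟩ := P.extMk_surjective α (n + 2) rfl
    rw [P.extMk_eq_zero_iff f _ rfl hf n rfl]
    exact h f hf
  · intro h f hf
    exact (P.extMk_eq_zero_iff (n := n + 1) f (n + 2) rfl hf n rfl).1 (Subsingleton.elim _ _)

/-- `R` has finite injective dimension over itself. -/
def HasFiniteSelfInjectiveDimension (R : Type u) [CommRing R] : Prop :=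
  ∃ n : ℕ, HasInjectiveDimensionLE (ModuleCat.of R R) n

theorem isGorensteinRing_iff {R : Type u} [CommRing R] :
    IsGorensteinRing R ↔ HasFiniteSelfInjectiveDimension R := by
  constructor
  · rintro ⟨n, h⟩
    refine ⟨n, .mk fun i hi N e => ?_⟩
    obtain ⟨i, rfl⟩ : ∃ j, i = j + 1 := ⟨i - 1, by lia⟩
    have := (subsingleton_ext_obj_iff N (ModuleCat.of R R) i).1 (h N (i + 1) (by lia))
    exact Subsingleton.elim _ _
  · rintro ⟨n, h⟩
    refine ⟨n, fun N i hi => ?_⟩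
    obtain ⟨i, rfl⟩ : ∃ j, i = j + 1 := ⟨i - 1, by lia⟩
    exact (subsingleton_ext_obj_iff N (ModuleCat.of R R) i).2
      (HasInjectiveDimensionLT.subsingleton _ (n + 1) _ (by lia) _)

theorem HasFiniteSelfInjectiveDimension.of_ringEquiv {R S : Type u} [CommRing R] [CommRing S]
    (e : R ≃+* S) (h : HasFiniteSelfInjectiveDimension R) :
    HasFiniteSelfInjectiveDimension S := by
  obtain ⟨n, h⟩ := h
  have := RingHomInvPair.of_ringEquiv e
  have := RingHomInvPair.symm (RingHomClass.toRingHom e) (RingHomClass.toRingHom e.symm)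
  let e' : ModuleCat.of R R ≃ₛₗ[RingHomClass.toRingHom e] ModuleCat.of S S :=
    { e.toAddEquiv with map_smul' := fun r x => map_mul e r x }
  exact ⟨n, (ModuleCat.hasInjectiveDimensionLE_iff_of_semiLinearEquiv e e' n).1 h⟩

section Ext

variable {R : Type u} [CommRing R]

theorem ModuleCat.shortExact_of_exact {A B C : Type u} [AddCommGroup A] [AddCommGroup B]
    [AddCommGroup C] [Module R A] [Module R B] [Module R C] {f : A →ₗ[R] B} {g : B →ₗ[R] C}
    (hf : Function.Injective f) (hg : Function.Surjective g) (h : Function.Exact f g) :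
    (ModuleCat.shortComplexOfCompEqZero f g h.linearMap_comp_eq_zero).ShortExact :=
  ModuleCat.shortComplex_shortExact _ h hf hg

theorem module_baer_of_subsingleton_ext_one {M : Type u} [AddCommGroup M] [Module R M]
    (h : ∀ J : Ideal R, Subsingleton (Abelian.Ext (ModuleCat.of R (R ⧸ J)) (ModuleCat.of R M) 1)) :
    Module.Baer R M := by
  intro J g
  have hS := ModuleCat.shortExact_of_exact (f := J.subtype) (g := Submodule.mkQ J)
    J.injective_subtype (Submodule.mkQ_surjective J) (LinearMap.exact_subtype_mkQ J)
  have := h J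
  obtain ⟨x, hx⟩ := Ext.contravariant_sequence_exact₁ hS (ModuleCat.of R M)
    (Ext.mk₀ (ModuleCat.ofHom g)) (n₁ := 1) rfl (by exact Subsingleton.elim _ _)
  obtain ⟨y, rfl⟩ := Ext.mk₀_bijective _ _ |>.2 x
  rw [Ext.mk₀_comp_mk₀] at hx
  have hy := (Ext.mk₀_bijective _ _).1 hx
  exact ⟨y.hom, fun x hx => congr($hy ⟨x, hx⟩)⟩

theorem hasInjectiveDimensionLE_zero_iff_baer {M : Type u} [AddCommGroup M] [Module R M] :
    HasInjectiveDimensionLE (ModuleCat.of R M) 0 ↔ Module.Baer R M := by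
  rw [Module.Baer.iff_injective, Module.injective_iff_injective_object]
  exact injective_iff_hasInjectiveDimensionLT_one.symm

/-- A dimension shift along an embedding into an injective module. -/
theorem exists_exact_injective (M : Type u) [AddCommGroup M] [Module R M] :
    ∃ (E : Type u) (_ : AddCommGroup E) (_ : Module R E) (f : M →ₗ[R] E),
      Module.Injective R E ∧ Function.Injective f := by
  obtain ⟨E, hE, f, hf⟩ := EnoughInjectives.presentation (ModuleCat.of R M)
  exact ⟨E, inferInstance, inferInstance, f.hom, Module.injective_module_of_injective_object R E,
    (ModuleCat.mono_iff_injective f).1 hf⟩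

theorem hasInjectiveDimensionLE_of_forall_quotient (n : ℕ) {M : Type u} [AddCommGroup M]
    [Module R M] (h : ∀ J : Ideal R,
      Subsingleton (Abelian.Ext (ModuleCat.of R (R ⧸ J)) (ModuleCat.of R M) (n + 1))) :
    HasInjectiveDimensionLE (ModuleCat.of R M) n := by
  induction n generalizing M with
  | zero => exact hasInjectiveDimensionLE_zero_iff_baer.2 (module_baer_of_subsingleton_ext_one h)
  | succ n ih =>
    obtain ⟨E, _, _, f, hE, hf⟩ := exists_exact_injective (R := R) M
    have hS := ModuleCat.shortExact_of_exact (f := f) (g := Submodule.mkQ f.range)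
      hf (Submodule.mkQ_surjective _) f.exact_map_mkQ_range
    have hE' : Injective (ModuleCat.of R E) := Module.injective_object_of_injective_module R E
    refine (hS.hasInjectiveDimensionLT_X₃_iff n hE').1 (ih fun J => ?_)
    refine subsingleton_of_forall_eq 0 fun α => ?_
    have := h J
    obtain ⟨β, rfl⟩ := Ext.covariant_sequence_exact₃ _ hS α rfl (by exact Subsingleton.elim _ _)
    rw [Ext.eq_zero_of_injective (I := ModuleCat.of R E) β, Ext.zero_comp]

end Ext

section ExtLocal

variable {R : Type u} [CommRing R]

theorem subsingleton_ext_of_exact {M : ModuleCat.{u} R} {i : ℕ} {N₁ N₂ N₃ : Type u}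
    [AddCommGroup N₁] [Module R N₁] [AddCommGroup N₂] [Module R N₂] [AddCommGroup N₃] [Module R N₃]
    {f : N₁ →ₗ[R] N₂} {g : N₂ →ₗ[R] N₃} (hf : Function.Injective f) (hg : Function.Surjective g)
    (h : Function.Exact f g) (h₁ : Subsingleton (Ext (ModuleCat.of R N₁) M i))
    (h₃ : Subsingleton (Ext (ModuleCat.of R N₃) M i)) :
    Subsingleton (Ext (ModuleCat.of R N₂) M i) := by
  refine subsingleton_of_forall_eq 0 fun α => ?_
  obtain ⟨β, rfl⟩ := Ext.contravariant_sequence_exact₂ (ModuleCat.shortExact_of_exact hf hg h) M α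
    (by exact Subsingleton.elim _ _)
  rw [show β = 0 from h₃.elim _ _, Ext.comp_zero]

theorem subsingleton_ext_of_iso {M : ModuleCat.{u} R} {i : ℕ} {N₁ N₂ : ModuleCat.{u} R}
    (e : N₁ ≅ N₂) (h : Subsingleton (Ext N₁ M i)) : Subsingleton (Ext N₂ M i) := by
  refine subsingleton_of_forall_eq 0 fun α => ?_
  have : (Ext.mk₀ e.inv).comp ((Ext.mk₀ e.hom).comp α (zero_add i)) (zero_add i) = α := by
    simp
  rw [← this, h.elim ((Ext.mk₀ e.hom).comp α (zero_add i)) 0, Ext.comp_zero]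

theorem CategoryTheory.Abelian.Ext.mk₀_smul_id_comp {X Y : ModuleCat.{u} R} {n : ℕ} (r : R)
    (α : Ext X Y n) : (Ext.mk₀ (r • 𝟙 X)).comp α (zero_add n) = r • α := by
  simp [Ext.mk₀_smul]

theorem CategoryTheory.Abelian.Ext.comp_mk₀_smul_id {X Y : ModuleCat.{u} R} {n : ℕ} (r : R)
    (α : Ext X Y n) : α.comp (Ext.mk₀ (r • 𝟙 Y)) (add_zero n) = r • α := by
  simp [Ext.mk₀_smul]

variable [IsLocalRing R]

theorem subsingleton_of_surjective_smul {M : Type*} [AddCommGroup M] [Module R M]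
    [Module.Finite R M] {x : R} (hx : x ∈ maximalIdeal R) (h : ∀ y : M, ∃ z, x • z = y) :
    Subsingleton M := by
  refine (Submodule.subsingleton_iff R).1 (subsingleton_iff_bot_eq_top.1 (Eq.symm ?_))
  refine Submodule.eq_bot_of_le_smul_of_le_jacobson_bot (maximalIdeal R) ⊤ Module.Finite.fg_top
    (fun y _ => ?_) (IsLocalRing.maximalIdeal_le_jacobson _)
  obtain ⟨z, rfl⟩ := h y
  exact Submodule.smul_mem_smul hx trivial

variable [IsNoetherianRing R]

theorem subsingleton_ext_of_isSMulRegular {M N : Type u} [AddCommGroup M] [Module R M]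
    [Module.Finite R M] [AddCommGroup N] [Module R N] [Module.Finite R N] {x : R}
    (hx : x ∈ maximalIdeal R) (hN : IsSMulRegular N x) (i : ℕ)
    (h : Subsingleton (Ext (ModuleCat.of R (QuotSMulTop x N)) (ModuleCat.of R M) (i + 1))) :
    Subsingleton (Ext (ModuleCat.of R N) (ModuleCat.of R M) i) := by
  refine subsingleton_of_surjective_smul hx fun α => ?_
  have hS : ((ModuleCat.of R N).smulShortComplex x).ShortExact :=
    IsSMulRegular.smulShortComplex_shortExact (M := ModuleCat.of R N) hN
  obtain ⟨β, hβ⟩ := Ext.contravariant_sequence_exact₁ hS (ModuleCat.of R M) α (n₁ := i + 1)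
    (add_comm _ _) (h.elim _ _)
  refine ⟨β, ?_⟩
  exact (Ext.mk₀_smul_id_comp x β).symm.trans hβ

/-- If `Ext^{i+1}(-, M)` vanishes on finite modules and `Ext^i(k, M) = 0` for the residue field
`k`, then `Ext^i(-, M)` vanishes on finite modules. -/
theorem subsingleton_ext_of_residueField {M : Type u} [AddCommGroup M] [Module R M]
    [Module.Finite R M] (i : ℕ)
    (h₁ : ∀ (N : Type u) [AddCommGroup N] [Module R N] [Module.Finite R N],
      Subsingleton (Ext (ModuleCat.of R N) (ModuleCat.of R M) (i + 1)))
    (h₀ : Subsingleton (Ext (ModuleCat.of R (R ⧸ maximalIdeal R)) (ModuleCat.of R M) i))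
    (N : Type u) [AddCommGroup N] [Module R N] [Module.Finite R N] :
    Subsingleton (Ext (ModuleCat.of R N) (ModuleCat.of R M) i) := by
  refine IsNoetherianRing.induction_on_isQuotientEquivQuotientPrime R (M := N) inferInstance
    (motive := fun N _ _ _ => Subsingleton (Ext (ModuleCat.of R N) (ModuleCat.of R M) i))
    ?_ ?_ ?_
  · intro N _ _ _ _
    refine subsingleton_of_forall_eq 0 fun α => ?_
    rw [← Ext.mk₀_id_comp α, (ModuleCat.isZero_of_subsingleton (ModuleCat.of R N)).eq_of_src
      (𝟙 _) 0, Ext.mk₀_zero, Ext.zero_comp]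
  · intro N _ _ _ p e
    refine subsingleton_ext_of_iso e.toModuleIso.symm ?_
    by_cases hp : p.1 = maximalIdeal R
    · rwa [hp]
    · obtain ⟨x, hx, hxp⟩ := Set.not_subset.1 fun h =>
        hp (le_antisymm (le_maximalIdeal p.2.ne_top) h)
      refine subsingleton_ext_of_isSMulRegular hx ?_ i (h₁ _)
      rw [isSMulRegular_iff_right_eq_zero_of_smul]
      intro y hy
      obtain ⟨y, rfl⟩ := Ideal.Quotient.mk_surjective y
      rw [Algebra.smul_def, Ideal.Quotient.algebraMap_eq, ← map_mul,
        Ideal.Quotient.eq_zero_iff_mem] at hy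
      exact Ideal.Quotient.eq_zero_iff_mem.2 ((p.2.mem_or_mem hy).resolve_left hxp)
  · intro N₁ _ _ _ N₂ _ _ _ N₃ _ _ _ f g hf hg h h1 h3
    exact subsingleton_ext_of_exact hf hg h h1 h3

/-- The injective dimension of a finite module is at most that of its quotient by a regular
element. -/
theorem hasInjectiveDimensionLE_of_isSMulRegular {M : Type u} [AddCommGroup M] [Module R M]
    [Module.Finite R M] {x : R} (hx : x ∈ maximalIdeal R) (hM : IsSMulRegular M x) (n : ℕ)
    (h : HasInjectiveDimensionLE (ModuleCat.of R (QuotSMulTop x M)) n) :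
    HasInjectiveDimensionLE (ModuleCat.of R M) n := by
  refine hasInjectiveDimensionLE_of_forall_quotient n fun J => ?_
  refine subsingleton_of_surjective_smul hx fun α => ?_
  have hS : ((ModuleCat.of R M).smulShortComplex x).ShortExact :=
    IsSMulRegular.smulShortComplex_shortExact (M := ModuleCat.of R M) hM
  obtain ⟨β, hβ⟩ := Ext.covariant_sequence_exact₂ (ModuleCat.of R (R ⧸ J)) hS α
    ((HasInjectiveDimensionLT.subsingleton (ModuleCat.of R (QuotSMulTop x M)) (n + 1) _ le_rfl
      _).elim _ _)
  refine ⟨β, ?_⟩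
  exact (Ext.comp_mk₀_smul_id x β).symm.trans hβ

/-- A local ring with finite self-injective dimension whose maximal ideal is associated is
self-injective. -/
theorem baer_self_of_maximalIdeal_mem_associatedPrimes
    (hR : HasFiniteSelfInjectiveDimension R) (hm : maximalIdeal R ∈ associatedPrimes R R) :
    Module.Baer R R := by
  obtain ⟨n, hn⟩ := hR
  induction n with
  | zero => exact hasInjectiveDimensionLE_zero_iff_baer.1 hn
  | succ n ih =>
    refine ih (hasInjectiveDimensionLE_of_forall_quotient n fun J => ?_)
    have h₁ (N : Type u) [AddCommGroup N] [Module R N] :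
        Subsingleton (Ext (ModuleCat.of R N) (ModuleCat.of R R) (n + 1 + 1)) :=
      HasInjectiveDimensionLT.subsingleton _ _ _ le_rfl _
    refine subsingleton_ext_of_residueField (n + 1) (fun N _ _ _ => h₁ N) ?_ _
    obtain ⟨f, hf⟩ := (isAssociatedPrime_iff_exists_injective_linearMap _ _).1 hm |>.2
    have hS := ModuleCat.shortExact_of_exact (g := Submodule.mkQ f.range)
      hf (Submodule.mkQ_surjective _) f.exact_map_mkQ_range
    refine subsingleton_of_forall_eq 0 fun α => ?_
    obtain ⟨β, rfl⟩ := Ext.contravariant_sequence_exact₁ hS (ModuleCat.of R R) α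
      (add_comm _ _) ((h₁ _).elim _ _)
    rw [Ext.eq_zero_of_projective (P := ModuleCat.of R R) β, Ext.comp_zero]

end ExtLocal

section DoubleAnnihilator

variable {R : Type u} [CommRing R]

theorem annihilator_annihilator_le_of_baer_self [IsLocalRing R] [IsNoetherianRing R]
    (hR : Module.Baer R R) (hm : maximalIdeal R ∈ associatedPrimes R R) (a : Ideal R) :
    a.annihilator.annihilator ≤ a := by
  intro y hy
  by_contra hya
  obtain ⟨s, hs⟩ := (isAssociatedPrime_iff.1 hm).2
  let b : Ideal R := LinearMap.ker (LinearMap.toSpanSingleton R (R ⧸ a) (Ideal.Quotient.mk a y))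
  have hb : b ≤ LinearMap.ker (LinearMap.toSpanSingleton R R s) := by
    have : b ≤ maximalIdeal R := le_maximalIdeal fun h => hya <| by
      have : (1 : R) ∈ b := h ▸ Submodule.mem_top
      simpa [b, Ideal.Quotient.eq_zero_iff_mem] using this
    refine this.trans ?_
    rw [hs]
    intro r hr
    simpa [Submodule.mem_colon_singleton] using hr
  let f : (R ⧸ b) →ₗ[R] (R ⧸ a) := b.liftQ _ le_rfl
  have hf : Function.Injective f := LinearMap.ker_eq_bot.1 (Submodule.ker_liftQ_eq_bot _ _ _ le_rfl)
  obtain ⟨h, hh⟩ := hR.extension_property f hf (b.liftQ _ hb)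
  have h1 (r : R) : h (Ideal.Quotient.mk a r) = h 1 * r := by
    have : Ideal.Quotient.mk a r = r • (1 : R ⧸ a) := by
      simp [Algebra.smul_def]
    rw [this, map_smul, smul_eq_mul, mul_comm]
  have h2 : h (Ideal.Quotient.mk a y) = s := by
    have : h (f (Submodule.Quotient.mk 1)) = b.liftQ _ hb (Submodule.Quotient.mk 1) :=
      LinearMap.congr_fun hh (Submodule.Quotient.mk 1)
    rw [Submodule.liftQ_apply, Submodule.liftQ_apply] at this
    simpa using this
  have h3 : h 1 * y = 0 := by
    rw [mul_comm]
    refine Submodule.mem_annihilator.1 hy _ (Submodule.mem_annihilator.2 fun x hx => ?_)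
    rw [smul_eq_mul, ← h1, Ideal.Quotient.eq_zero_iff_mem.2 hx, map_zero]
  rw [← h1, h2] at h3
  refine (maximalIdeal.isMaximal R).ne_top ?_
  rw [hs, h3]
  simp

theorem Ideal.exists_pow_eq_bot_of_annihilator_annihilator_le [IsNoetherianRing R]
    {m : Ideal R} (hm : m ≤ jacobson ⊥)
    (h : ∀ n, m ^ n ≠ ⊥ → (m ^ n).annihilator.annihilator ≤ m ^ n) : ∃ n, m ^ n = ⊥ := by
  by_contra! hne
  let f : ℕ →o Ideal R :=
    ⟨fun n => (m ^ n).annihilator,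
      fun i j hij => Submodule.annihilator_mono (Ideal.pow_le_pow_right hij)⟩
  obtain ⟨n, hn⟩ := WellFoundedGT.monotone_chain_condition f
  have h1 : (m ^ n).annihilator = (m ^ (n + 1)).annihilator := hn (n + 1) (by lia)
  refine hne n (Submodule.eq_bot_of_le_smul_of_le_jacobson_bot m (m ^ n)
    (IsNoetherian.noetherian _) ?_ hm)
  rw [smul_eq_mul, ← pow_succ']
  refine le_trans ?_ (h _ (hne (n + 1)))
  rw [← h1]
  intro x hx
  refine Submodule.mem_annihilator.2 fun r hr => ?_
  rw [smul_eq_mul, mul_comm]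
  exact Submodule.mem_annihilator.1 hr x hx

/-- A Noetherian ring in which every ideal is a double annihilator is self-injective. -/
theorem baer_self_of_annihilator_annihilator_le [IsNoetherianRing R]
    (h : ∀ a : Ideal R, a.annihilator.annihilator ≤ a) : Module.Baer R R := by
  intro J g
  suffices H : ∀ J : Ideal R, ∀ g : J →ₗ[R] R, ∃ s : R, ∀ x (hx : x ∈ J), g ⟨x, hx⟩ = s * x by
    obtain ⟨s, hs⟩ := H J g
    exact ⟨LinearMap.toSpanSingleton R R s, fun x hx => by simp [hs x hx, mul_comm]⟩
  clear g J
  intro J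
  refine Submodule.fg_induction
    (motive := fun (J : Ideal R) _ =>
      ∀ g : J →ₗ[R] R, ∃ s : R, ∀ x (hx : x ∈ J), g ⟨x, hx⟩ = s * x) ?_ ?_ J
    (IsNoetherian.noetherian J)
  · intro x g
    have hx : x ∈ R ∙ x := Submodule.mem_span_singleton_self x
    have : g ⟨x, hx⟩ ∈ (Ideal.span {x}).annihilator.annihilator := by
      refine Submodule.mem_annihilator.2 fun r hr => ?_
      have := Submodule.mem_annihilator.1 hr x (Ideal.mem_span_singleton_self x)
      rw [smul_eq_mul, mul_comm, ← smul_eq_mul, ← map_smul]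
      rw [show r • (⟨x, hx⟩ : R ∙ x) = 0 from Subtype.ext this, map_zero]
    obtain ⟨s, hs⟩ := Ideal.mem_span_singleton'.1 (h _ this)
    refine ⟨s, fun y hy => ?_⟩
    obtain ⟨c, rfl⟩ := Submodule.mem_span_singleton.1 hy
    have : (⟨c • x, hy⟩ : R ∙ x) = c • ⟨x, hx⟩ := rfl
    rw [this, map_smul, ← hs]
    simp only [smul_eq_mul]; ring
  · intro a b _ _ ha hb g
    obtain ⟨s, hs⟩ := ha (g.comp (Submodule.inclusion le_sup_left))
    obtain ⟨t, ht⟩ := hb (g.comp (Submodule.inclusion le_sup_right))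
    have : s - t ∈ (a.annihilator ⊔ b.annihilator).annihilator.annihilator := by
      refine Submodule.mem_annihilator.2 fun r hr => ?_
      have hra : r ∈ a := h a (Submodule.annihilator_mono le_sup_left hr)
      have hrb : r ∈ b := h b (Submodule.annihilator_mono le_sup_right hr)
      have h1 := hs r hra
      have h2 := ht r hrb
      rw [smul_eq_mul, sub_mul, ← h1, ← h2, sub_eq_zero]
      rfl
    obtain ⟨u, hu, v, hv, huv⟩ := Submodule.mem_sup.1 (h _ this)
    refine ⟨s - u, fun x hx => ?_⟩
    obtain ⟨y, hy, z, hz, rfl⟩ := Submodule.mem_sup.1 hx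
    have h1 : g ⟨y, le_sup_left (b := b) hy⟩ = s * y := hs y hy
    have h2 : g ⟨z, le_sup_right (a := a) hz⟩ = t * z := ht z hz
    have : (⟨y + z, hx⟩ : ↥(a ⊔ b)) =
        ⟨y, le_sup_left (b := b) hy⟩ + ⟨z, le_sup_right (a := a) hz⟩ :=
      rfl
    rw [this, map_add, h1, h2]
    have h3 : u * y = 0 := Submodule.mem_annihilator.1 hu y hy
    have h4 : v * z = 0 := Submodule.mem_annihilator.1 hv z hz
    linear_combination h3 - h4 + huv * z

end DoubleAnnihilator

section TorsionBy

variable {R : Type u} [CommRing R] (x : R)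

/-- The map induced on `x`-torsion, linear over `R ⧸ (x)`. -/
def Submodule.torsionByMap {M N : Type*} [AddCommGroup M] [Module R M] [AddCommGroup N] [Module R N]
    (f : M →ₗ[R] N) : torsionBy R M x →ₗ[R ⧸ Ideal.span {x}] torsionBy R N x where
  toFun m := ⟨f m, by rw [mem_torsionBy_iff, ← map_smul, (mem_torsionBy_iff x _).1 m.2, map_zero]⟩
  map_add' _ _ := Subtype.ext (map_add f _ _)
  map_smul' s m := by
    obtain ⟨r, rfl⟩ := Ideal.Quotient.mk_surjective s
    exact Subtype.ext (map_smul f r m.1)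

theorem Submodule.torsionByMap_injective {M N : Type*} [AddCommGroup M] [Module R M]
    [AddCommGroup N] [Module R N] {f : M →ₗ[R] N} (hf : Function.Injective f) :
    Function.Injective (torsionByMap x f) := fun _ _ h =>
  Subtype.ext (hf congr(($h).1))

theorem baer_torsionBy {M : Type u} [AddCommGroup M] [Module R M] (hM : Module.Baer R M) :
    Module.Baer (R ⧸ Ideal.span {x}) (torsionBy R M x) := by
  intro J g
  let g₀ : J.comap (Ideal.Quotient.mk (Ideal.span {x})) →ₗ[R] M :=
    { toFun := fun r => (g ⟨Ideal.Quotient.mk _ r.1, r.2⟩).1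
      map_add' := fun r s => by
        rw [← Submodule.coe_add, ← map_add]
        rfl
      map_smul' := fun r s => by
        have := congrArg Subtype.val (map_smul g (Ideal.Quotient.mk (Ideal.span {x}) r)
          ⟨Ideal.Quotient.mk (Ideal.span {x}) s.1, s.2⟩)
        exact this }
  obtain ⟨h, hh⟩ := hM _ g₀
  have hx : x ∈ J.comap (Ideal.Quotient.mk (Ideal.span {x})) := by
    rw [Ideal.mem_comap, Ideal.Quotient.eq_zero_iff_mem.2 (Ideal.mem_span_singleton_self x)]
    exact J.zero_mem
  have h1 (r : R) : h r = r • h 1 := by rw [← map_smul, smul_eq_mul, mul_one]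
  have hx0 : x • h 1 = 0 := by
    rw [← h1, hh x hx]
    change (g ⟨Ideal.Quotient.mk _ x, _⟩).1 = 0
    have : (⟨Ideal.Quotient.mk _ x, hx⟩ : J) = 0 :=
      Subtype.ext (Ideal.Quotient.eq_zero_iff_mem.2 (Ideal.mem_span_singleton_self x))
    rw [this, map_zero, Submodule.coe_zero]
  refine ⟨LinearMap.toSpanSingleton _ _ ⟨h 1, hx0⟩, fun s hs => ?_⟩
  obtain ⟨r, rfl⟩ := Ideal.Quotient.mk_surjective s
  refine Subtype.ext ?_
  change r • h 1 = _
  rw [← h1, hh r hs]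
  rfl

variable {x}

theorem Module.Baer.exists_smul_eq {M : Type u} [AddCommGroup M] [Module R M]
    (hM : Module.Baer R M) (hx : IsSMulRegular R x) (m : M) : ∃ m', x • m' = m := by
  obtain ⟨h, hh⟩ := hM.extension_property (LinearMap.lsmul R R x) hx
    (LinearMap.toSpanSingleton R M m)
  have := LinearMap.congr_fun hh 1
  refine ⟨h 1, ?_⟩
  rw [← map_smul]
  simpa using this

theorem hasInjectiveDimensionLE_torsionBy (hx : IsSMulRegular R x) (n : ℕ) {M : Type u}
    [AddCommGroup M] [Module R M] (hM : ∀ m : M, ∃ m', x • m' = m)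
    (h : HasInjectiveDimensionLE (ModuleCat.of R M) n) :
    HasInjectiveDimensionLE (ModuleCat.of (R ⧸ Ideal.span {x}) (torsionBy R M x)) n := by
  induction n generalizing M with
  | zero =>
    exact hasInjectiveDimensionLE_zero_iff_baer.2
      (baer_torsionBy x (hasInjectiveDimensionLE_zero_iff_baer.1 h))
  | succ n ih =>
    obtain ⟨E, _, _, f, hE, hf⟩ := exists_exact_injective (R := R) M
    have hS := ModuleCat.shortExact_of_exact (f := f) (g := Submodule.mkQ f.range)
      hf (Submodule.mkQ_surjective _) f.exact_map_mkQ_range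
    have hE' : Injective (ModuleCat.of R E) := Module.injective_object_of_injective_module R E
    have hEx := (Module.Baer.iff_injective.2 hE).exists_smul_eq hx
    have hQ := (hS.hasInjectiveDimensionLT_X₃_iff n hE').2 h
    have hQ' := ih (fun q => by
      obtain ⟨e, rfl⟩ := Submodule.mkQ_surjective _ q
      obtain ⟨e', rfl⟩ := hEx e
      exact ⟨f.range.mkQ e', by rw [map_smul]⟩) hQ
    have hT := ModuleCat.shortExact_of_exact (f := torsionByMap x f)
      (g := torsionByMap x f.range.mkQ) (torsionByMap_injective x hf) ?_ ?_
    · have hE₂ : Injective (ModuleCat.of (R ⧸ Ideal.span {x}) (torsionBy R E x)) := by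
        have := Module.Baer.iff_injective.1 (baer_torsionBy x (Module.Baer.iff_injective.2 hE))
        exact Module.injective_object_of_injective_module _ _
      exact (hT.hasInjectiveDimensionLT_X₃_iff n hE₂).1 hQ'
    · rintro ⟨q, hq⟩
      obtain ⟨e, rfl⟩ := Submodule.mkQ_surjective _ q
      rw [mem_torsionBy_iff, ← map_smul, mkQ_apply, Quotient.mk_eq_zero] at hq
      obtain ⟨m, hm⟩ := hq
      obtain ⟨m', rfl⟩ := hM m
      refine ⟨⟨e - f m', ?_⟩, Subtype.ext ?_⟩
      · rw [mem_torsionBy_iff, smul_sub, ← hm, map_smul, sub_self]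
      · change f.range.mkQ (e - f m') = _
        rw [map_sub, sub_eq_self, mkQ_apply, Quotient.mk_eq_zero]
        exact ⟨m', rfl⟩
    · rintro ⟨e, he⟩
      constructor
      · intro h0
        have h0' : f.range.mkQ e = 0 := congr(($h0).1)
        rw [mkQ_apply, Quotient.mk_eq_zero] at h0'
        obtain ⟨m, rfl⟩ := h0'
        refine ⟨⟨m, hf ?_⟩, rfl⟩
        rw [map_zero, ← (mem_torsionBy_iff x _).1 he]
        exact map_smul f x m
      · rintro ⟨m, hm⟩
        have hm' : f m = e := congr(($hm).1)
        refine Subtype.ext ?_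
        change f.range.mkQ e = 0
        rw [mkQ_apply, Quotient.mk_eq_zero]
        exact ⟨m, hm'⟩

/-- The connecting map of the snake lemma for multiplication by `x`. -/
theorem exists_torsionBy_quotient_linearMap {E : Type u} [AddCommGroup E]
    [Module R E] {f : R →ₗ[R] E} (hf : Function.Injective f) (hE : ∀ e : E, ∃ e', x • e' = e) :
    ∃ g : torsionBy R (E ⧸ f.range) x →ₗ[R ⧸ Ideal.span {x}] (R ⧸ Ideal.span {x}),
      Function.Surjective g ∧ Function.Exact (torsionByMap x f.range.mkQ) g := by
  let P (q : torsionBy R (E ⧸ f.range) x) (s : R ⧸ Ideal.span {x}) : Prop :=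
    ∃ e r, f.range.mkQ e = q ∧ x • e = f r ∧ Ideal.Quotient.mk _ r = s
  have hP (q) : ∃ s, P q s := by
    obtain ⟨q, hq⟩ := q
    obtain ⟨e, rfl⟩ := Submodule.mkQ_surjective _ q
    rw [mem_torsionBy_iff, ← map_smul, mkQ_apply, Quotient.mk_eq_zero] at hq
    obtain ⟨r, hr⟩ := hq
    exact ⟨_, e, r, rfl, hr.symm, rfl⟩
  have hu {q s t} : P q s → P q t → s = t := by
    rintro ⟨e, r, he, her, rfl⟩ ⟨e', r', he', her', rfl⟩
    rw [← he', mkQ_apply, mkQ_apply, Submodule.Quotient.eq] at he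
    obtain ⟨a, ha⟩ := he
    rw [Ideal.Quotient.eq, Ideal.mem_span_singleton']
    refine ⟨a, hf ?_⟩
    rw [map_sub, ← her, ← her', ← smul_sub, ← ha, ← map_smul, smul_eq_mul, mul_comm]
  choose g hg using hP
  refine ⟨⟨⟨g, fun q q' => hu (hg _) ?_⟩, fun s q => hu (hg _) ?_⟩, fun s => ?_, fun q => ?_⟩
  · obtain ⟨e, r, he, her, hr⟩ := hg q
    obtain ⟨e', r', he', her', hr'⟩ := hg q'
    exact ⟨e + e', r + r', by rw [map_add, he, he']; rfl, by rw [smul_add, her, her', map_add],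
      by rw [map_add, hr, hr']⟩
  · obtain ⟨e, r, he, her, hr⟩ := hg q
    obtain ⟨s, rfl⟩ := Ideal.Quotient.mk_surjective s
    exact ⟨s • e, s * r, by rw [map_smul, he]; rfl,
      by rw [smul_comm, her, ← smul_eq_mul, map_smul], by rw [map_mul, hr]; rfl⟩
  · obtain ⟨r, rfl⟩ := Ideal.Quotient.mk_surjective s
    obtain ⟨e, he⟩ := hE (f r)
    refine ⟨⟨f.range.mkQ e, ?_⟩, hu (hg _) ⟨e, r, rfl, he, rfl⟩⟩
    rw [mem_torsionBy_iff, ← map_smul, he, mkQ_apply, Quotient.mk_eq_zero]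
    exact ⟨r, rfl⟩
  · constructor
    · intro h0
      have h0' : g q = 0 := h0
      obtain ⟨e, r, he, her, hr⟩ := hg q
      rw [h0', Ideal.Quotient.eq_zero_iff_mem, Ideal.mem_span_singleton'] at hr
      obtain ⟨a, rfl⟩ := hr
      refine ⟨⟨e - f a, ?_⟩, Subtype.ext ?_⟩
      · rw [mem_torsionBy_iff, smul_sub, her, ← map_smul, smul_eq_mul, mul_comm, sub_self]
      · change f.range.mkQ (e - f a) = _
        rw [← he, map_sub, sub_eq_self, mkQ_apply, Quotient.mk_eq_zero]
        exact ⟨a, rfl⟩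
    · rintro ⟨e, rfl⟩
      exact hu (hg _) ⟨e.1, 0, rfl,
        by rw [map_zero]; exact (mem_torsionBy_iff x _).1 e.2, map_zero _⟩

theorem HasFiniteSelfInjectiveDimension.quotient_span_singleton (hx : IsSMulRegular R x)
    (h : HasFiniteSelfInjectiveDimension R) :
    HasFiniteSelfInjectiveDimension (R ⧸ Ideal.span {x}) := by
  obtain ⟨n, hn⟩ := h
  obtain ⟨E, _, _, f, hE, hf⟩ := exists_exact_injective (R := R) R
  have hS := ModuleCat.shortExact_of_exact (f := f) (g := Submodule.mkQ f.range)
    hf (Submodule.mkQ_surjective _) f.exact_map_mkQ_range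
  have hE' : Injective (ModuleCat.of R E) := Module.injective_object_of_injective_module R E
  have hBE := Module.Baer.iff_injective.2 hE
  have hEx := hBE.exists_smul_eq hx
  have hQ : HasInjectiveDimensionLE (ModuleCat.of R (E ⧸ f.range)) n :=
    (hS.hasInjectiveDimensionLT_X₃_iff n hE').2 (hasInjectiveDimensionLT_of_ge _ (n + 1) _ (by lia))
  have hQ' := hasInjectiveDimensionLE_torsionBy hx n (fun q => by
      obtain ⟨e, rfl⟩ := Submodule.mkQ_surjective _ q
      obtain ⟨e', rfl⟩ := hEx e
      exact ⟨f.range.mkQ e', by rw [map_smul]⟩) hQ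
  have hE₂ := hasInjectiveDimensionLE_zero_iff_baer.2 (baer_torsionBy x hBE)
  obtain ⟨g, hg, hex⟩ := exists_torsionBy_quotient_linearMap hf hEx
  have hT := ModuleCat.shortExact_of_exact (f := torsionByMap x f.range.mkQ) ?_ hg hex
  · exact ⟨n, hT.hasInjectiveDimensionLT_X₃ (n + 1) hQ'
      (hasInjectiveDimensionLT_of_ge (ModuleCat.of _ (torsionBy R E x)) 1 (n + 1 + 1) (by lia))⟩
  · rw [← LinearMap.ker_eq_bot, eq_bot_iff]
    rintro ⟨e, he⟩ h0
    have h0' : f.range.mkQ e = 0 := congr(($h0).1)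
    rw [mkQ_apply, Quotient.mk_eq_zero] at h0'
    obtain ⟨r, rfl⟩ := h0'
    rw [mem_torsionBy_iff, ← map_smul] at he
    have : r = 0 := isSMulRegular_iff_right_eq_zero_of_smul.1 hx r (hf (he.trans (map_zero f).symm))
    subst this
    exact Subtype.ext (map_zero f)

end TorsionBy

section QuotientRegular

variable {R : Type u} [CommRing R] {x : R}

theorem hasInjectiveDimensionLE_one_of_baer (hx : IsSMulRegular R x) {N : Type u}
    [AddCommGroup N] [Module R N] [Module (R ⧸ Ideal.span {x}) N]
    [IsScalarTower R (R ⧸ Ideal.span {x}) N] (hN : Module.Baer (R ⧸ Ideal.span {x}) N) :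
    HasInjectiveDimensionLE (ModuleCat.of R N) 1 := by
  obtain ⟨E, _, _, f, hE, hf⟩ := exists_exact_injective (R := R) N
  have hE' : Injective (ModuleCat.of R E) := Module.injective_object_of_injective_module R E
  have hBE := Module.Baer.iff_injective.2 hE
  have hS := ModuleCat.shortExact_of_exact (f := (torsionBy R E x).subtype)
    (g := LinearMap.lsmul R E x) (Submodule.subtype_injective _) (hBE.exists_smul_eq hx)
    (fun e => by simp)
  have hE₂ : HasInjectiveDimensionLE (ModuleCat.of R (torsionBy R E x)) 1 :=
    (hS.hasInjectiveDimensionLT_X₃_iff 0 hE').1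
      (injective_iff_hasInjectiveDimensionLT_one.1 hE')
  let j : N →ₗ[R ⧸ Ideal.span {x}] torsionBy R E x :=
    { toFun := fun n => ⟨f n, by
        rw [mem_torsionBy_iff, ← map_smul, ← algebraMap_smul (R ⧸ Ideal.span {x}) x n,
          Ideal.Quotient.algebraMap_eq,
          Ideal.Quotient.eq_zero_iff_mem.2 (Ideal.mem_span_singleton_self x), zero_smul, map_zero]⟩
      map_add' := fun _ _ => Subtype.ext (map_add f _ _)
      map_smul' := fun s n => by
        obtain ⟨r, rfl⟩ := Ideal.Quotient.mk_surjective s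
        refine Subtype.ext ?_
        change f (algebraMap R (R ⧸ Ideal.span {x}) r • n) = r • f n
        rw [algebraMap_smul, map_smul] }
  have hj : Function.Injective j := fun _ _ h => hf congr(($h).1)
  obtain ⟨p, hp⟩ := hN.extension_property j hj LinearMap.id
  let j' : N →ₗ[R] torsionBy R E x := f.codRestrict _ fun n => (j n).2
  let p' : torsionBy R E x →ₗ[R] N :=
    { toFun := p
      map_add' := map_add p
      map_smul' := fun r e => by
        have := map_smul p (Ideal.Quotient.mk _ r) e
        rw [torsionBy.mk_ideal_smul] at this
        rw [this, ← Ideal.Quotient.algebraMap_eq, algebraMap_smul]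
        rfl }
  let ret : Retract (ModuleCat.of R N) (ModuleCat.of R (torsionBy R E x)) :=
    { i := ModuleCat.ofHom j'
      r := ModuleCat.ofHom p'
      retract := by
        ext n
        exact LinearMap.congr_fun hp n }
  exact ret.hasInjectiveDimensionLT 2

/-- Injective dimension goes up by at most one along the quotient by a regular element. -/
theorem hasInjectiveDimensionLE_succ_of_quotient (hx : IsSMulRegular R x) (n : ℕ) {N : Type u}
    [AddCommGroup N] [Module R N] [Module (R ⧸ Ideal.span {x}) N]
    [IsScalarTower R (R ⧸ Ideal.span {x}) N]
    (hN : HasInjectiveDimensionLE (ModuleCat.of (R ⧸ Ideal.span {x}) N) n) :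
    HasInjectiveDimensionLE (ModuleCat.of R N) (n + 1) := by
  induction n generalizing N with
  | zero =>
    exact hasInjectiveDimensionLE_one_of_baer hx (hasInjectiveDimensionLE_zero_iff_baer.1 hN)
  | succ n ih =>
    obtain ⟨J, _, _, f, hJ, hf⟩ := exists_exact_injective (R := R ⧸ Ideal.span {x}) N
    have hS := ModuleCat.shortExact_of_exact (f := f) (g := Submodule.mkQ f.range)
      hf (Submodule.mkQ_surjective _) f.exact_map_mkQ_range
    have hJ' : Injective (ModuleCat.of (R ⧸ Ideal.span {x}) J) :=
      Module.injective_object_of_injective_module _ J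
    let : Module R J := Module.compHom J (algebraMap R (R ⧸ Ideal.span {x}))
    have : IsScalarTower R (R ⧸ Ideal.span {x}) J := .of_algebraMap_smul fun _ _ => rfl
    have hQ₀ : HasInjectiveDimensionLE (ModuleCat.of (R ⧸ Ideal.span {x}) (J ⧸ f.range)) n :=
      (hS.hasInjectiveDimensionLT_X₃_iff n hJ').2 hN
    have hQ := ih hQ₀
    have hJ₁ := hasInjectiveDimensionLE_one_of_baer hx (Module.Baer.iff_injective.2 hJ)
    have hg : Function.Surjective f.range.mkQ := Submodule.mkQ_surjective _
    have hS' := ModuleCat.shortExact_of_exact (f := f.restrictScalars R)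
      (g := f.range.mkQ.restrictScalars R) hf hg f.exact_map_mkQ_range
    exact hS'.hasInjectiveDimensionLT_X₁ (n + 2) hQ
      (hasInjectiveDimensionLT_of_ge (ModuleCat.of R J) 2 (n + 2 + 1) (by lia))

variable [IsLocalRing R] [IsNoetherianRing R]

/-- The linear equivalence between `R/xR` and the quotient ring `R ⧸ (x)`. -/
noncomputable def quotSMulTopEquivQuotientSpan (R : Type*) [CommRing R] (x : R) :
    QuotSMulTop x R ≃ₗ[R] R ⧸ Ideal.span {x} :=
  Submodule.quotEquivOfEq _ _ (by simp [← Submodule.ideal_span_singleton_smul])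

theorem HasFiniteSelfInjectiveDimension.of_quotient_span_singleton (hx : IsSMulRegular R x)
    (hxm : x ∈ maximalIdeal R) (h : HasFiniteSelfInjectiveDimension (R ⧸ Ideal.span {x})) :
    HasFiniteSelfInjectiveDimension R := by
  obtain ⟨n, hn⟩ := h
  have h1 := hasInjectiveDimensionLE_succ_of_quotient hx n hn
  refine ⟨n + 1, hasInjectiveDimensionLE_of_isSMulRegular hxm hx (n + 1) ?_⟩
  exact (ModuleCat.hasInjectiveDimensionLE_iff_of_linearEquiv
    (M := ModuleCat.of R (QuotSMulTop x R)) (N := ModuleCat.of R (R ⧸ Ideal.span {x}))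
    (quotSMulTopEquivQuotientSpan R x) _).2 h1

/-- Finite self-injective dimension is invariant under passing to the quotient by a regular
sequence. -/
theorem hasFiniteSelfInjectiveDimension_quotient_ofList_iff {R : Type u} [CommRing R]
    [IsLocalRing R] [IsNoetherianRing R] {rs : List R} (hrs : IsRegular R rs) :
    HasFiniteSelfInjectiveDimension (R ⧸ Ideal.ofList rs) ↔ HasFiniteSelfInjectiveDimension R := by
  generalize hn : rs.length = n
  induction n generalizing R with
  | zero =>
    obtain rfl := List.length_eq_zero_iff.1 hn
    let e : R ⧸ Ideal.ofList ([] : List R) ≃+* R :=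
      (Ideal.quotEquivOfEq Ideal.ofList_nil).trans (RingEquiv.quotientBot R)
    exact ⟨.of_ringEquiv e, .of_ringEquiv e.symm⟩
  | succ n ih =>
    match rs, hn with
    | r :: rs, hn =>
      have hmem : r ∈ maximalIdeal R := le_maximalIdeal
        (J := Ideal.ofList (r :: rs))
        (by simpa using hrs.top_ne_smul.symm) (Ideal.subset_span (by simp : r ∈ {x | x ∈ r :: rs}))
      rw [isRegular_cons_iff] at hrs
      obtain ⟨hr, hrs⟩ := hrs
      let S := R ⧸ Ideal.span {r}
      have : Nontrivial S := Ideal.Quotient.nontrivial_iff.2 fun h =>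
        (maximalIdeal.isMaximal R).ne_top
          (top_le_iff.1 (h ▸ (Ideal.span_singleton_le_iff_mem _).2 hmem))
      have : IsLocalRing S := .of_surjective' (Ideal.Quotient.mk _) Ideal.Quotient.mk_surjective
      have hrs' : IsRegular S (rs.map (algebraMap R S)) := by
        rw [(quotSMulTopEquivQuotientSpan R r).isRegular_congr] at hrs
        refine (AddEquiv.isRegular_congr (e := AddEquiv.refl S) ?_).1 hrs
        rw [List.forall₂_map_right_iff, List.forall₂_same]
        intro r _ y
        rw [AddEquiv.refl_apply, AddEquiv.refl_apply, algebraMap_smul]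
      have h1 := ih hrs' (by simpa using hn)
      have h2 : HasFiniteSelfInjectiveDimension S ↔ HasFiniteSelfInjectiveDimension R :=
        ⟨.of_quotient_span_singleton hr hmem, .quotient_span_singleton hr⟩
      rw [← h2, ← h1]
      let e : R ⧸ Ideal.ofList (r :: rs) ≃+* S ⧸ Ideal.ofList (rs.map (algebraMap R S)) :=
        (Ideal.quotEquivOfEq (Ideal.ofList_cons r rs)).trans
          ((DoubleQuot.quotQuotEquivQuotSup _ _).symm.trans
            (Ideal.quotEquivOfEq (Ideal.map_ofList _ _)))
      exact ⟨.of_ringEquiv e, .of_ringEquiv e.symm⟩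

end QuotientRegular

section RegularSequences

open scoped Pointwise

variable {R : Type*} [CommRing R]

theorem ringKrullDim_quotient_succ_le_of_mem {p P : Ideal R} [p.IsPrime] (hpP : p ≤ P) {x : R}
    (hxp : x ∉ p) (hxP : x ∈ P) : ringKrullDim (R ⧸ P) + 1 ≤ ringKrullDim (R ⧸ p) := by
  refine ringKrullDim_succ_le_of_surjective (Ideal.Quotient.factor hpP)
    (Ideal.Quotient.factor_surjective hpP) (r := Ideal.Quotient.mk p x) ?_ ?_
  · rw [mem_nonZeroDivisors_iff_ne_zero]
    simpa [Ideal.Quotient.eq_zero_iff_mem] using hxp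
  · simpa [Ideal.Quotient.eq_zero_iff_mem] using hxP

theorem RingTheory.Sequence.IsRegular.mem_maximalIdeal [IsLocalRing R] {M : Type*}
    [AddCommGroup M] [Module R M] {rs : List R} (h : IsRegular M rs) {x : R} (hx : x ∈ rs) :
    x ∈ maximalIdeal R := by
  have hne : Ideal.ofList rs ≠ ⊤ := by
    intro h'
    exact h.top_ne_smul (by rw [h', Submodule.top_smul])
  exact le_maximalIdeal hne (Ideal.subset_span hx)

theorem length_le_ringKrullDim_quotient_of_mem_associatedPrimes [IsLocalRing R]
    [IsNoetherianRing R] {M : Type*} [AddCommGroup M] [Module R M] [Module.Finite R M]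
    {rs : List R} (hrs : IsRegular M rs) {q : Ideal R} (hq : q ∈ associatedPrimes R M) :
    (rs.length : WithBot ℕ∞) ≤ ringKrullDim (R ⧸ q) := by
  induction rs generalizing M q with
  | nil =>
    have := hq.isPrime
    simpa using ringKrullDim_nonneg_of_nontrivial (R := R ⧸ q)
  | cons x rs ih =>
    have hxm : x ∈ maximalIdeal R := hrs.mem_maximalIdeal (by simp)
    rw [isRegular_cons_iff] at hrs
    have hqp := hq.isPrime
    obtain ⟨z, hz⟩ := (isAssociatedPrime_iff.1 hq).2
    have hz0 : z ≠ 0 := by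
      rintro rfl
      exact hqp.ne_top (hz.trans (by simp [Ideal.eq_top_iff_one, mem_colon_singleton]))
    have hmem : ∀ r : R, r ∈ q ↔ r • z = 0 := fun r ↦ by rw [hz, mem_colon_singleton]; simp
    have hxq : x ∉ q := fun h ↦ hz0 (hrs.1 (by simpa using (hmem x).1 h))
    let K : Submodule R M :=
      { carrier := {y | ∀ r ∈ q, r • y = 0}
        add_mem' := fun ha hb r hr ↦ by rw [smul_add, ha r hr, hb r hr, add_zero]
        zero_mem' := fun r _ ↦ smul_zero r
        smul_mem' := fun c y hy r hr ↦ by rw [smul_comm, hy r hr, smul_zero] }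
    have hzK : z ∈ K := fun r hr ↦ (hmem r).1 hr
    obtain ⟨y, hyK, hy⟩ : ∃ y ∈ K, y ∉ x • (⊤ : Submodule R M) := by
      by_contra! hcon
      have : Subsingleton K := subsingleton_of_surjective_smul hxm fun y ↦ by
        obtain ⟨w, -, hw⟩ := (Submodule.mem_smul_pointwise_iff_exists _ _ _).1 (hcon y y.2)
        refine ⟨⟨w, fun r hr ↦ hrs.1 ?_⟩, Subtype.ext hw⟩
        simpa [smul_comm x r, hw] using y.2 r hr
      exact hz0 (congrArg Subtype.val (Subsingleton.elim (⟨z, hzK⟩ : K) 0))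
    have hy0 : (Submodule.Quotient.mk y : QuotSMulTop x M) ≠ 0 := by
      rwa [Ne, Submodule.Quotient.mk_eq_zero]
    obtain ⟨P, hP, hle⟩ := exists_le_isAssociatedPrime_of_isNoetherianRing R _ hy0
    have hqP : q ≤ P := fun r hr ↦ hle (by
      rw [mem_colon_singleton, ← Submodule.Quotient.mk_smul, hyK r hr]; simp)
    have hxP : x ∈ P := hle (by
      rw [mem_colon_singleton, ← Submodule.Quotient.mk_smul]
      exact (Submodule.Quotient.mk_eq_zero _).2
        (Submodule.smul_mem_pointwise_smul y x ⊤ trivial))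
    calc ((x :: rs).length : WithBot ℕ∞) = (rs.length : WithBot ℕ∞) + 1 := by simp
      _ ≤ ringKrullDim (R ⧸ P) + 1 := by gcongr; exact ih hrs.2 hP
      _ ≤ _ := ringKrullDim_quotient_succ_le_of_mem hqP hxq hxP

theorem exists_ringKrullDim_eq_natCast (R : Type*) [CommRing R] [FiniteRingKrullDim R] :
    ∃ n : ℕ, ringKrullDim R = n := by
  obtain ⟨m, hm⟩ := WithBot.ne_bot_iff_exists.1 (ringKrullDim_ne_bot (R := R))
  obtain ⟨n, rfl⟩ := ENat.ne_top_iff_exists.1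
    (fun h : m = ⊤ ↦ ringKrullDim_ne_top (R := R) (by rw [← hm, h]; rfl))
  exact ⟨n, hm.symm⟩

theorem RingTheory.Sequence.IsRegular.nontrivial_quotient_ofList {rs : List R}
    (h : IsRegular R rs) : Nontrivial (R ⧸ Ideal.ofList rs) :=
  Ideal.Quotient.nontrivial_iff.2 fun h' ↦ h.top_ne_smul (by rw [h', Submodule.top_smul])

theorem exists_isRegular_append_maximal [IsLocalRing R] [IsNoetherianRing R] {rs : List R}
    (hrs : IsRegular R rs) : ∃ ts, IsRegular R (rs ++ ts) ∧
      ∀ us, IsRegular R (rs ++ us) → us.length ≤ ts.length := by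
  obtain ⟨n, hn⟩ : ∃ n : ℕ, ∀ us : List R, IsRegular R (rs ++ us) → us.length ≤ n := by
    obtain ⟨n, hn⟩ := exists_ringKrullDim_eq_natCast R
    refine ⟨n, fun us hus ↦ ?_⟩
    have := hus.nontrivial_quotient_ofList
    have : IsLocalRing (R ⧸ Ideal.ofList (rs ++ us)) :=
      .of_surjective' _ Ideal.Quotient.mk_surjective
    have h3 := ringKrullDim_add_length_eq_ringKrullDim_of_isRegular _ hus
    obtain ⟨k, hk⟩ := exists_ringKrullDim_eq_natCast (R ⧸ Ideal.ofList (rs ++ us))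
    rw [hn, hk, List.length_append] at h3
    norm_cast at h3
    omega
  classical
  let p : ℕ → Prop := fun k ↦ ∃ ts, IsRegular R (rs ++ ts) ∧ ts.length = k
  have hp0 : p 0 := ⟨[], by simpa using hrs, rfl⟩
  obtain ⟨ts, hts, hl⟩ := Nat.findGreatest_spec (P := p) (Nat.zero_le n) hp0
  exact ⟨ts, hts, fun us hus ↦ hl ▸ Nat.le_findGreatest (hn us hus) ⟨us, hus, rfl⟩⟩

theorem exists_le_associatedPrimes_of_forall_not_isRegular [IsLocalRing R] [IsNoetherianRing R]
    {rs : List R} (hrs : IsRegular R rs) {a : Ideal R} (ha : a ≠ ⊤)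
    (h : ∀ y ∈ a, ¬ IsRegular R (rs ++ [y])) :
    ∃ q ∈ associatedPrimes R (R ⧸ Ideal.ofList rs), a ≤ q := by
  refine (Ideal.subset_union_prime_finite (associatedPrimes.finite R _) 0 0
    fun I hin _ _ ↦ IsAssociatedPrime.isPrime hin).1 ?_
  rw [biUnion_associatedPrimes_eq_compl_regular R (R ⧸ Ideal.ofList rs)]
  intro y hy hreg
  refine h y hy ?_
  rw [IsLocalRing.isRegular_iff_isWeaklyRegular_of_subset_maximalIdeal,
    isWeaklyRegular_append_iff, isWeaklyRegular_singleton_iff]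
  · refine ⟨hrs.toIsWeaklyRegular, ?_⟩
    have e : (Ideal.ofList rs • ⊤ : Submodule R R) = Ideal.ofList rs := by simp
    exact ((Submodule.quotEquivOfEq _ _ e).isSMulRegular_congr y).2 hreg
  · intro r hr
    rcases List.mem_append.1 hr with hr | hr
    · exact hrs.mem_maximalIdeal hr
    · rw [List.mem_singleton.1 hr]
      exact le_maximalIdeal ha hy

end RegularSequences

section CohenMacaulay

theorem Ideal.map_mk_mem_associatedPrimes {R : Type*} [CommRing R] [IsNoetherianRing R]
    {J p : Ideal R} (hp : p ∈ associatedPrimes R (R ⧸ J)) :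
    J ≤ p ∧ p.map (Ideal.Quotient.mk J) ∈ associatedPrimes (R ⧸ J) (R ⧸ J) := by
  have hpp := hp.isPrime
  obtain ⟨x, hx⟩ := (isAssociatedPrime_iff.1 hp).2
  have hmem : ∀ r : R, r ∈ p ↔ Ideal.Quotient.mk J r * x = 0 := fun r ↦ by
    rw [hx, mem_colon_singleton, Submodule.mem_bot, Algebra.smul_def]; rfl
  have hJ : J ≤ p := fun r hr ↦ by
    rw [hmem, Ideal.Quotient.eq_zero_iff_mem.2 hr, zero_mul]
  refine ⟨hJ, isAssociatedPrime_iff.2 ⟨?_, x, ?_⟩⟩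
  · exact Ideal.map_isPrime_of_surjective Ideal.Quotient.mk_surjective (by simpa using hJ)
  · ext s
    obtain ⟨r, rfl⟩ := Ideal.Quotient.mk_surjective s
    rw [Ideal.mem_quotient_iff_mem hJ, hmem, mem_colon_singleton, smul_eq_mul, Submodule.mem_bot]

theorem maximalIdeal_quotient_mem_associatedPrimes {R : Type*} [CommRing R] [IsNoetherianRing R]
    [IsLocalRing R] {J : Ideal R} [IsLocalRing (R ⧸ J)]
    (h : maximalIdeal R ∈ associatedPrimes R (R ⧸ J)) :
    maximalIdeal (R ⧸ J) ∈ associatedPrimes (R ⧸ J) (R ⧸ J) := by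
  obtain ⟨hJ, hm⟩ := Ideal.map_mk_mem_associatedPrimes h
  have : (maximalIdeal R).map (Ideal.Quotient.mk J) = maximalIdeal (R ⧸ J) := by
    refine eq_maximalIdeal ?_
    exact (Ideal.map_eq_top_or_isMaximal_of_surjective _ Ideal.Quotient.mk_surjective
      inferInstance).resolve_left hm.isPrime.ne_top
  rwa [this] at hm

theorem ringKrullDim_eq_zero_of_pow_maximalIdeal_eq_bot {R : Type*} [CommRing R]
    [IsNoetherianRing R] [IsLocalRing R] {n : ℕ} (hn : maximalIdeal R ^ n = ⊥) :
    ringKrullDim R = 0 := by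
  have : IsArtinianRing R := (isArtinianRing_iff_isNilpotent_maximalIdeal R).2 ⟨n, hn⟩
  exact ringKrullDimZero_iff_ringKrullDim_eq_zero.1 inferInstance

variable {R : Type u} [CommRing R] [IsNoetherianRing R]

theorem HasFiniteSelfInjectiveDimension.ringKrullDim_eq_zero [IsLocalRing R]
    (hR : HasFiniteSelfInjectiveDimension R) (hm : maximalIdeal R ∈ associatedPrimes R R) :
    ringKrullDim R = 0 := by
  have hB := baer_self_of_maximalIdeal_mem_associatedPrimes hR hm
  obtain ⟨n, hn⟩ := Ideal.exists_pow_eq_bot_of_annihilator_annihilator_le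
    (IsLocalRing.jacobson_eq_maximalIdeal (R := R) ⊥ bot_ne_top).ge
    fun n _ ↦ annihilator_annihilator_le_of_baer_self hB hm (maximalIdeal R ^ n)
  exact ringKrullDim_eq_zero_of_pow_maximalIdeal_eq_bot hn

theorem maximalIdeal_mem_associatedPrimes_of_forall_not_isRegular {R : Type*} [CommRing R]
    [IsNoetherianRing R] [IsLocalRing R] {rs : List R} (hrs : IsRegular R rs)
    (h : ∀ y, ¬ IsRegular R (rs ++ [y])) :
    maximalIdeal R ∈ associatedPrimes R (R ⧸ Ideal.ofList rs) := by
  obtain ⟨q, hq, hle⟩ := exists_le_associatedPrimes_of_forall_not_isRegular hrs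
    (Ideal.IsPrime.ne_top' (I := maximalIdeal R)) fun y _ ↦ h y
  rwa [← (maximalIdeal.isMaximal R).eq_of_le hq.isPrime.ne_top hle] at hq

theorem HasFiniteSelfInjectiveDimension.ringKrullDim_quotient_ofList_le [IsLocalRing R]
    (hR : HasFiniteSelfInjectiveDimension R) {rs : List R} (hrs : IsRegular R rs) {q : Ideal R}
    (hq : q ∈ associatedPrimes R (R ⧸ Ideal.ofList rs)) :
    ringKrullDim (R ⧸ Ideal.ofList rs) ≤ ringKrullDim (R ⧸ q) := by
  obtain ⟨ts, hts, hmax⟩ := exists_isRegular_append_maximal hrs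
  have hm := maximalIdeal_mem_associatedPrimes_of_forall_not_isRegular hts fun y hy ↦ by
    have := hmax (ts ++ [y]) (by simpa using hy)
    simp at this
  have := hts.nontrivial_quotient_ofList
  have : IsLocalRing (R ⧸ Ideal.ofList (rs ++ ts)) :=
    .of_surjective' _ Ideal.Quotient.mk_surjective
  have h0 := ((hasFiniteSelfInjectiveDimension_quotient_ofList_iff hts).2 hR).ringKrullDim_eq_zero
    (maximalIdeal_quotient_mem_associatedPrimes hm)
  have := hrs.nontrivial_quotient_ofList
  have : IsLocalRing (R ⧸ Ideal.ofList rs) := .of_surjective' _ Ideal.Quotient.mk_surjective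
  have h1 := ringKrullDim_add_length_eq_ringKrullDim_of_isRegular _ hts
  have h2 := ringKrullDim_add_length_eq_ringKrullDim_of_isRegular _ hrs
  obtain ⟨k, hk⟩ := exists_ringKrullDim_eq_natCast (R ⧸ Ideal.ofList rs)
  rw [h0, ← h2, hk, List.length_append] at h1
  norm_cast at h1
  rw [hk, show k = ts.length by omega]
  refine length_le_ringKrullDim_quotient_of_mem_associatedPrimes ?_ hq
  rw [IsLocalRing.isRegular_iff_isWeaklyRegular_of_subset_maximalIdeal fun r hr ↦
    hts.mem_maximalIdeal (List.mem_append_right _ hr)]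
  have e : (Ideal.ofList rs • ⊤ : Submodule R R) = Ideal.ofList rs := by simp
  exact ((Submodule.quotEquivOfEq _ _ e).isWeaklyRegular_congr ts).1
    ((isWeaklyRegular_append_iff R rs ts).1 hts.toIsWeaklyRegular).2

theorem HasFiniteSelfInjectiveDimension.localization
    (hR : HasFiniteSelfInjectiveDimension R) (S : Submonoid R) :
    HasFiniteSelfInjectiveDimension (Localization S) := by
  obtain ⟨n, hn⟩ := hR
  refine ⟨n, ?_⟩
  have h := ModuleCat.localizedModule_hasInjectiveDimensionLE n S (ModuleCat.of R R)
  let e : Shrink.{u} (LocalizedModule S R) ≃ₗ[Localization S] Localization S :=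
    (Shrink.linearEquiv (Localization S) _).trans
      ((IsLocalizedModule.linearEquiv S (LocalizedModule.mkLinearMap S R)
        (Algebra.linearMap R (Localization S))).extendScalarsOfIsLocalization S (Localization S))
  exact (ModuleCat.hasInjectiveDimensionLE_iff_of_linearEquiv
    (M := (ModuleCat.of R R).localizedModule S)
    (N := ModuleCat.of (Localization S) (Localization S)) e n).1 h

theorem HasFiniteSelfInjectiveDimension.exists_notMem_mul_mem
    (hR : HasFiniteSelfInjectiveDimension R) {P : Ideal R} (hP : P ∈ associatedPrimes R R)
    {a : Ideal R} {w : R} (hw : w ∈ a.annihilator.annihilator) : ∃ v ∉ P, v * w ∈ a := by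
  have hPp := hP.isPrime
  let A := Localization.AtPrime P
  have hm : maximalIdeal A ∈ associatedPrimes A A := by
    open Module.associatedPrimes in
    refine mem_associatedPrimes_of_comap_mem_associatedPrimes_of_isLocalizedModule
      P.primeCompl (Algebra.linearMap R A) _ ?_
    have : (maximalIdeal A).comap (algebraMap R A) = P :=
      IsLocalization.AtPrime.under_maximalIdeal A P
    rwa [this]
  have hA := hR.localization P.primeCompl
  have hB := baer_self_of_maximalIdeal_mem_associatedPrimes (R := A) hA hm
  have key : algebraMap R A w ∈ a.map (algebraMap R A) := by
    refine annihilator_annihilator_le_of_baer_self hB hm _ ?_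
    rw [Submodule.mem_annihilator]
    intro s hs
    obtain ⟨r, u, rfl⟩ := IsLocalization.exists_mk'_eq P.primeCompl s
    have hs' : ∀ b ∈ a, ∃ v ∉ P, v * (r * b) = 0 := by
      intro b hb
      have h0 := Submodule.mem_annihilator.1 hs _ (Ideal.mem_map_of_mem (algebraMap R A) hb)
      rw [smul_eq_mul, mul_comm, IsLocalization.mul_mk'_eq_mk'_of_mul,
        IsLocalization.mk'_eq_zero_iff] at h0
      obtain ⟨v, hv⟩ := h0
      exact ⟨v, v.2, by rw [mul_comm r b]; exact hv⟩
    obtain ⟨v, hvP, hv⟩ : ∃ v ∉ P, ∀ b ∈ a, v * (r * b) = 0 := by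
      obtain ⟨t, rfl⟩ := IsNoetherian.noetherian a
      choose! f hfP hf using hs'
      refine ⟨∏ b ∈ t, f b, fun h ↦ ?_, fun b hb ↦ ?_⟩
      · obtain ⟨b, hb, hbP⟩ := (hPp.prod_mem_iff).1 h
        exact hfP b (Ideal.subset_span hb) hbP
      · induction hb using Submodule.span_induction with
        | mem b hb =>
          exact zero_dvd_iff.1 ((hf b (Ideal.subset_span hb)) ▸
            mul_dvd_mul_right (Finset.dvd_prod_of_mem f hb) _)
        | zero => simp
        | add b c _ _ hb hc => rw [mul_add, mul_add, hb, hc, add_zero]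
        | smul c b _ hb =>
          rw [smul_eq_mul, mul_left_comm r, mul_left_comm, hb, mul_zero]
    have hvr : v * r ∈ a.annihilator := Submodule.mem_annihilator.2 fun b hb ↦ by
      rw [smul_eq_mul, mul_assoc, hv b hb]
    have h0 := Submodule.mem_annihilator.1 hw _ hvr
    rw [smul_eq_mul, IsLocalization.mul_mk'_eq_mk'_of_mul, IsLocalization.mk'_eq_zero_iff]
    exact ⟨⟨v, hvP⟩, by rw [← h0, smul_eq_mul]; ring⟩
  obtain ⟨v, hv, h⟩ :=
    (IsLocalization.algebraMap_mem_map_algebraMap_iff P.primeCompl A a w).1 key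
  exact ⟨v, hv, h⟩

end CohenMacaulay

section Linkage

theorem Ideal.mk_mem_annihilator_map_iff {R : Type*} [CommRing R] {I a : Ideal R} {y : R} :
    Ideal.Quotient.mk I y ∈ (a.map (Ideal.Quotient.mk I)).annihilator ↔
      y ∈ Submodule.colon I (a : Set R) := by
  rw [Submodule.mem_annihilator, Submodule.mem_colon]
  constructor
  · intro h b hb
    rw [smul_eq_mul, ← Ideal.Quotient.eq_zero_iff_mem, map_mul]
    exact h _ (Ideal.mem_map_of_mem _ hb)
  · intro h s hs
    obtain ⟨b, hb, rfl⟩ := (Ideal.mem_map_iff_of_surjective _ Ideal.Quotient.mk_surjective).1 hs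
    rw [smul_eq_mul, ← map_mul, Ideal.Quotient.eq_zero_iff_mem]
    exact h b hb

theorem Ideal.map_mk_colon {R : Type*} [CommRing R] (I a : Ideal R) :
    (Submodule.colon I (a : Set R)).map (Ideal.Quotient.mk I) =
      (a.map (Ideal.Quotient.mk I)).annihilator := by
  ext s
  rw [Ideal.mem_map_iff_of_surjective _ Ideal.Quotient.mk_surjective]
  constructor
  · rintro ⟨y, hy, rfl⟩
    exact Ideal.mk_mem_annihilator_map_iff.2 hy
  · intro hs
    obtain ⟨y, rfl⟩ := Ideal.Quotient.mk_surjective s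
    exact ⟨y, Ideal.mk_mem_annihilator_map_iff.1 hs, rfl⟩

theorem Ideal.mem_colon_colon_iff {R : Type*} [CommRing R] {I a : Ideal R} {y : R} :
    y ∈ Submodule.colon I (Submodule.colon I (a : Set R) : Set R) ↔
      Ideal.Quotient.mk I y ∈ (a.map (Ideal.Quotient.mk I)).annihilator.annihilator := by
  rw [← Ideal.mk_mem_annihilator_map_iff, Ideal.map_mk_colon]

theorem Ideal.le_colon_colon {R : Type*} [CommRing R] (I a : Ideal R) :
    a ≤ Submodule.colon I (Submodule.colon I (a : Set R) : Set R) := fun y hy ↦ by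
  rw [Submodule.mem_colon]
  intro z hz
  rw [smul_eq_mul, mul_comm]
  exact Submodule.mem_colon.1 hz y hy

theorem maximalIdeal_map_mk_le {R : Type*} [CommRing R] [IsLocalRing R] (J : Ideal R)
    [IsLocalRing (R ⧸ J)] :
    (maximalIdeal R).map (Ideal.Quotient.mk J) ≤ maximalIdeal (R ⧸ J) := by
  have : IsLocalHom (Ideal.Quotient.mk J) := .of_surjective _ Ideal.Quotient.mk_surjective
  exact ((IsLocalRing.local_hom_TFAE (Ideal.Quotient.mk J)).out 0 2).1 this

theorem ringKrullDim_quotient_eq_zero_of_pow_le {R : Type*} [CommRing R] [IsNoetherianRing R]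
    [IsLocalRing R] {n : ℕ} {c : Ideal R} (hc : c ≠ ⊤) (hn : maximalIdeal R ^ n ≤ c) :
    ringKrullDim (R ⧸ c) = 0 := by
  have := Ideal.Quotient.nontrivial_iff.2 hc
  have : IsLocalRing (R ⧸ c) := .of_surjective' _ Ideal.Quotient.mk_surjective
  have hcomap : (maximalIdeal (R ⧸ c)).comap (Ideal.Quotient.mk c) ≤ maximalIdeal R :=
    le_maximalIdeal (Ideal.comap_ne_top _ Ideal.IsPrime.ne_top')
  have hle : maximalIdeal (R ⧸ c) ≤ (maximalIdeal R).map (Ideal.Quotient.mk c) := by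
    rw [← Ideal.map_comap_of_surjective _ Ideal.Quotient.mk_surjective (maximalIdeal (R ⧸ c))]
    exact Ideal.map_mono hcomap
  refine ringKrullDim_eq_zero_of_pow_maximalIdeal_eq_bot (n := n) ?_
  rw [eq_bot_iff, ← Ideal.map_quotient_self c]
  refine (Ideal.pow_right_mono hle n).trans ?_
  rw [← Ideal.map_pow]
  exact Ideal.map_mono hn

variable {R : Type u} [CommRing R] [IsNoetherianRing R] [IsLocalRing R]

/-- Over a local ring of finite self-injective dimension, an unmixed ideal is equal to its double
colon with respect to a maximal regular sequence inside it. -/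
theorem HasFiniteSelfInjectiveDimension.colon_colon_le (hR : HasFiniteSelfInjectiveDimension R)
    {a : Ideal R} (ha : a ≠ ⊤)
    (hunm : ∀ p ∈ associatedPrimes R (R ⧸ a), ringKrullDim (R ⧸ p) = ringKrullDim (R ⧸ a))
    {rs : List R} (hrs : IsRegular R rs) (hrsa : Ideal.ofList rs ≤ a)
    (hmax : ∀ y ∈ a, ¬ IsRegular R (rs ++ [y])) :
    Submodule.colon (Ideal.ofList rs) (Submodule.colon (Ideal.ofList rs) (a : Set R) : Set R)
      ≤ a := by
  set I := Ideal.ofList rs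
  intro y hy
  by_contra hya
  let K : Submodule R (R ⧸ a) :=
    Submodule.map (Submodule.mkQ a) (Submodule.colon I (Submodule.colon I (a : Set R) : Set R))
  have hK : Nontrivial K := by
    refine ⟨⟨⟨Submodule.mkQ a y, Submodule.mem_map_of_mem hy⟩, 0, fun h ↦ hya ?_⟩⟩
    exact (Submodule.Quotient.mk_eq_zero a).1 (congrArg Subtype.val h)
  obtain ⟨p, hp⟩ := associatedPrimes.nonempty R K
  have hpp := hp.isPrime
  obtain ⟨⟨_, w, hw, rfl⟩, hx⟩ := (isAssociatedPrime_iff.1 hp).2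
  have hpw : ∀ r, r ∈ p ↔ r * w ∈ a := fun r ↦ by
    rw [hx, mem_colon_singleton, Submodule.mem_bot, Subtype.ext_iff]
    exact Submodule.Quotient.mk_eq_zero a
  have hpa : p ∈ associatedPrimes R (R ⧸ a) :=
    hp.map_of_injective K.subtype K.injective_subtype
  have hap : a ≤ p := fun r hr ↦ (hpw r).2 (a.mul_mem_right w hr)
  obtain ⟨q, hq, haq⟩ := exists_le_associatedPrimes_of_forall_not_isRegular hrs ha hmax
  have hdim : ringKrullDim (R ⧸ I) ≤ ringKrullDim (R ⧸ p) :=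
    (hR.ringKrullDim_quotient_ofList_le hrs hq).trans <| (hunm p hpa).symm ▸
      ringKrullDim_le_of_surjective _ (Ideal.Quotient.factor_surjective haq)
  have hpmin : p ∈ I.minimalPrimes := by
    obtain ⟨p₀, hp₀, hle⟩ := Ideal.exists_minimalPrimes_le (hrsa.trans hap)
    by_cases heq : p₀ = p
    · exact heq ▸ hp₀
    have := hp₀.1.1
    obtain ⟨x, hxp, hxp₀⟩ := SetLike.exists_of_lt (lt_of_le_of_ne hle heq)
    have h1 := ringKrullDim_quotient_succ_le_of_mem hle hxp₀ hxp
    have h2 : ringKrullDim (R ⧸ p₀) ≤ ringKrullDim (R ⧸ I) :=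
      ringKrullDim_le_of_surjective _ (Ideal.Quotient.factor_surjective hp₀.1.2)
    have : IsLocalRing (R ⧸ p) := .of_surjective' _ Ideal.Quotient.mk_surjective
    obtain ⟨k, hk⟩ := exists_ringKrullDim_eq_natCast (R ⧸ p)
    have h3 := h1.trans (h2.trans hdim)
    rw [hk] at h3
    norm_cast at h3
    omega
  have hpI : p ∈ associatedPrimes R (R ⧸ I) :=
    Module.associatedPrimes.minimalPrimes_annihilator_subset_associatedPrimes R (R ⧸ I)
      (by rwa [Ideal.annihilator_quotient])
  obtain ⟨hIp, hP⟩ := Ideal.map_mk_mem_associatedPrimes hpI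
  obtain ⟨v, hv, hvw⟩ := ((hasFiniteSelfInjectiveDimension_quotient_ofList_iff hrs).2
    hR).exists_notMem_mul_mem hP (Ideal.mem_colon_colon_iff.1 hw)
  obtain ⟨v, rfl⟩ := Ideal.Quotient.mk_surjective v
  rw [Ideal.mem_quotient_iff_mem hIp] at hv
  rw [← map_mul, Ideal.mem_quotient_iff_mem hrsa] at hvw
  exact hv ((hpw v).2 hvw)

theorem not_isRegular_append_of_length_eq_gradeIdeal {R : Type*} [CommRing R] {a : Ideal R}
    {rs : List R} (hrsa : ∀ x ∈ rs, x ∈ a) (h : (rs.length : ℕ∞) = gradeIdeal a) {y : R}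
    (hy : y ∈ a) : ¬ IsRegular R (rs ++ [y]) := fun hreg ↦ by
  have h1 : ((rs ++ [y]).length : ℕ∞) ≤ gradeIdeal a := le_sSup ⟨_, rfl, hreg, fun x hx ↦ by
    rcases List.mem_append.1 hx with hx | hx
    · exact hrsa x hx
    · rwa [List.mem_singleton.1 hx]⟩
  rw [← h, Nat.cast_le] at h1
  simp at h1

theorem length_eq_gradeIdeal {R : Type*} [CommRing R] {a : Ideal R}
    {rs : List R} (hrs : IsRegular R rs) (hrsa : ∀ x ∈ rs, x ∈ a)
    (hmax : ∀ us : List R, IsRegular R us → us.length ≤ rs.length) :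
    (rs.length : ℕ∞) = gradeIdeal a := by
  refine le_antisymm (le_sSup ⟨rs, rfl, hrs, hrsa⟩) (sSup_le ?_)
  rintro _ ⟨us, rfl, hus, -⟩
  exact_mod_cast hmax us hus

theorem hasFiniteSelfInjectiveDimension_of_colon_colon
    (h : ∀ a : Ideal R, a ≠ ⊥ → a ≠ ⊤ →
      (∀ p ∈ associatedPrimes R (R ⧸ a), ringKrullDim (R ⧸ p) = ringKrullDim (R ⧸ a)) →
      ∀ rs : List R, IsRegular R rs → (∀ x ∈ rs, x ∈ a) →
        (rs.length : ℕ∞) = gradeIdeal a → Ideal.ofList rs ≠ a →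
        Submodule.colon (Ideal.ofList rs) (Submodule.colon (Ideal.ofList rs) (a : Set R) : Set R)
          = a) :
    HasFiniteSelfInjectiveDimension R := by
  obtain ⟨rs, hrs, hmax⟩ := exists_isRegular_append_maximal (IsRegular.nil R R)
  simp only [List.nil_append] at hrs hmax
  refine (hasFiniteSelfInjectiveDimension_quotient_ofList_iff hrs).1 ?_
  have := hrs.nontrivial_quotient_ofList
  set I := Ideal.ofList rs
  have : IsLocalRing (R ⧸ I) := .of_surjective' _ Ideal.Quotient.mk_surjective
  have key : ∀ (b : Ideal (R ⧸ I)) (n : ℕ), maximalIdeal (R ⧸ I) ^ n ≤ b → b ≠ ⊥ →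
      b.annihilator.annihilator ≤ b := by
    intro b n hn hb
    rcases eq_or_ne b ⊤ with rfl | hbt
    · exact le_top
    let a := b.comap (Ideal.Quotient.mk I)
    have hab : a.map (Ideal.Quotient.mk I) = b :=
      Ideal.map_comap_of_surjective _ Ideal.Quotient.mk_surjective b
    have hna : maximalIdeal R ^ n ≤ a := by
      rw [← Ideal.map_le_iff_le_comap, Ideal.map_pow]
      exact (Ideal.pow_right_mono (maximalIdeal_map_mk_le I) n).trans hn
    have hat : a ≠ ⊤ := Ideal.comap_ne_top _ hbt
    have hrsa : ∀ x ∈ rs, x ∈ a := fun x hx ↦ by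
      have hxI : x ∈ I := Ideal.subset_span hx
      rw [Ideal.mem_comap, Ideal.Quotient.eq_zero_iff_mem.2 hxI]
      exact b.zero_mem
    have haa := h a (fun ha ↦ hb (by rw [← hab, ha, Ideal.map_bot])) hat
      (fun p hp ↦ by
        rw [ringKrullDim_quotient_eq_zero_of_pow_le hat hna,
          ringKrullDim_quotient_eq_zero_of_pow_le hp.isPrime.ne_top
            (hna.trans (Ideal.map_mk_mem_associatedPrimes hp).1)])
      rs hrs hrsa (length_eq_gradeIdeal hrs hrsa hmax)
      (fun hIa ↦ hb (by rw [← hab, ← hIa, Ideal.map_quotient_self]))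
    intro y hy
    obtain ⟨y, rfl⟩ := Ideal.Quotient.mk_surjective y
    rw [← hab, ← Ideal.mem_colon_colon_iff, haa] at hy
    exact hy
  obtain ⟨N, hN⟩ := Ideal.exists_pow_eq_bot_of_annihilator_annihilator_le
    (IsLocalRing.jacobson_eq_maximalIdeal (R := R ⧸ I) ⊥ bot_ne_top).ge
    fun n hn ↦ key _ n le_rfl hn
  refine ⟨0, hasInjectiveDimensionLE_zero_iff_baer.2
    (baer_self_of_annihilator_annihilator_le fun b ↦ ?_)⟩
  rcases eq_or_ne b ⊥ with rfl | hb
  · rw [Submodule.annihilator_bot, Submodule.annihilator_top]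
    exact (Module.annihilator_eq_bot.2 inferInstance).le
  · exact key b N (hN ▸ bot_le) hb

end Linkage

end

/-- A Noetherian local ring `R` is Gorenstein iff every nonzero proper
unmixed ideal `a` is linked by every ideal generated by an `R`-regular sequence contained in
`a` of length `grade a` and different from `a`; that is,
`(x₁,…,x_t) : ((x₁,…,x_t) : a) = a` for every such regular sequence. -/
theorem stmt_18 (R : Type u) [CommRing R] [IsNoetherianRing R] [IsLocalRing R] :
    IsGorensteinRing R ↔
      ∀ a : Ideal R, a ≠ ⊥ → a ≠ ⊤ →
        (∀ p ∈ associatedPrimes R (R ⧸ a), ringKrullDim (R ⧸ p) = ringKrullDim (R ⧸ a)) →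
        ∀ rs : List R, RingTheory.Sequence.IsRegular R rs → (∀ x ∈ rs, x ∈ a) →
          (rs.length : ℕ∞) = gradeIdeal a → Ideal.ofList rs ≠ a →
          Submodule.colon (Ideal.ofList rs) (Submodule.colon (Ideal.ofList rs) a) = a := by
  rw [isGorensteinRing_iff]
  refine ⟨fun hR a _ ha hunm rs hrs hrsa hlen _ ↦ le_antisymm ?_ (Ideal.le_colon_colon _ a),
    hasFiniteSelfInjectiveDimension_of_colon_colon⟩
  exact hR.colon_colon_le ha hunm hrs (Ideal.span_le.2 hrsa)
    fun y hy ↦ not_isRegular_append_of_length_eq_gradeIdeal hrsa hlen hy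
end
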